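/- arXiv:math/0505474 — 2 statements merged into one kernel-verified Lean document; each statement's English description precedes it below -/
import Mathlib

section
/- Let m₁, m₂ be positive integers and set d := gcd(m₁, m₂). On the quotient space Q := 𝔈/(𝔏₁ + 𝔏₂), consider the operators induced by φ(u) := (∂₁u − m₁·z₁^{−m₁−1}z₂^{−m₂}·u, ∂₂u − m₂·z₁^{−m₁}z₂^{−m₂−1}·u) and ψ(ω₁, ω₂) := ∂₁ω₂ − ∂₂ω₁ + m₂·z₁^{−m₁}z₂^{−m₂−1}·ω₁ − m₁·z₁^{−m₁−1}z₂^{−m₂}·ω₂. Then: (i) φ and ψ map 𝔏₁ + 𝔏₂ (respectively (𝔏₁+𝔏₂) ⊕ (𝔏₁+𝔏₂)) into (𝔏₁+𝔏₂) ⊕ (𝔏₁+𝔏₂) (respectively 𝔏₁+𝔏₂), so they descend to maps φ̄ : Q → Q ⊕ Q and ψ̄ : Q ⊕ Q → Q with ψ̄ ∘ φ̄ = 0; (ii) dim ker φ̄ = d; (iii) dim((ker ψ̄)/(im φ̄)) = d; (iv) ψ̄ is surjective. -/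
/-- `A = {z ∈ ℂ² : z₁ ≠ 0 and z₂ ≠ 0}`. -/
def Aset : Set (ℂ × ℂ) := {z | z.1 ≠ 0 ∧ z.2 ≠ 0}

/-- Representatives of germs in `𝔈`: total functions that are holomorphic on
`V ∩ A` for some open neighbourhood `V` of the origin. -/
def Esp : Set (ℂ × ℂ → ℂ) :=
  {f | ∃ V : Set (ℂ × ℂ), IsOpen V ∧ ((0 : ℂ), (0 : ℂ)) ∈ V ∧
    DifferentiableOn ℂ f (V ∩ Aset)}

/-- Representatives of germs in `𝔏₁`: for some `N`, `z₂^N·f` extends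
holomorphically to `V ∩ {z₁ ≠ 0}`. -/
def L1set : Set (ℂ × ℂ → ℂ) :=
  {f | ∃ V : Set (ℂ × ℂ), IsOpen V ∧ ((0 : ℂ), (0 : ℂ)) ∈ V ∧
    ∃ (N : ℕ) (g : ℂ × ℂ → ℂ),
      DifferentiableOn ℂ g (V ∩ {z : ℂ × ℂ | z.1 ≠ 0}) ∧
      ∀ z ∈ V ∩ Aset, g z = z.2 ^ N * f z}

/-- Representatives of germs in `𝔏₂`: for some `N`, `z₁^N·f` extends
holomorphically to `V ∩ {z₂ ≠ 0}`. -/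
def L2set : Set (ℂ × ℂ → ℂ) :=
  {f | ∃ V : Set (ℂ × ℂ), IsOpen V ∧ ((0 : ℂ), (0 : ℂ)) ∈ V ∧
    ∃ (N : ℕ) (g : ℂ × ℂ → ℂ),
      DifferentiableOn ℂ g (V ∩ {z : ℂ × ℂ | z.2 ≠ 0}) ∧
      ∀ z ∈ V ∩ Aset, g z = z.1 ^ N * f z}

/-- Representatives of germs in `𝔏₁ + 𝔏₂`. -/
def L12set : Set (ℂ × ℂ → ℂ) :=
  {f | ∃ f₁ f₂ : ℂ × ℂ → ℂ, f₁ ∈ L1set ∧ f₂ ∈ L2set ∧ f = f₁ + f₂}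

/-- First complex partial derivative. -/
noncomputable def pd1 (f : ℂ × ℂ → ℂ) : ℂ × ℂ → ℂ :=
  fun x => deriv (fun w => f (w, x.2)) x.1

/-- Second complex partial derivative. -/
noncomputable def pd2 (f : ℂ × ℂ → ℂ) : ℂ × ℂ → ℂ :=
  fun x => deriv (fun w => f (x.1, w)) x.2

/-- First component of `φ(u) = (∂₁u − m₁z₁^{−m₁−1}z₂^{−m₂}u, ∂₂u − m₂z₁^{−m₁}z₂^{−m₂−1}u)`. -/
noncomputable def φ1 (m₁ m₂ : ℕ) (u : ℂ × ℂ → ℂ) : ℂ × ℂ → ℂ :=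
  fun x => pd1 u x - (m₁ : ℂ) * x.1 ^ (-(m₁ : ℤ) - 1) * x.2 ^ (-(m₂ : ℤ)) * u x

/-- Second component of `φ`. -/
noncomputable def φ2 (m₁ m₂ : ℕ) (u : ℂ × ℂ → ℂ) : ℂ × ℂ → ℂ :=
  fun x => pd2 u x - (m₂ : ℂ) * x.1 ^ (-(m₁ : ℤ)) * x.2 ^ (-(m₂ : ℤ) - 1) * u x

/-- `ψ(ω₁,ω₂) = ∂₁ω₂ − ∂₂ω₁ + m₂z₁^{−m₁}z₂^{−m₂−1}ω₁ − m₁z₁^{−m₁−1}z₂^{−m₂}ω₂`. -/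
noncomputable def ψop (m₁ m₂ : ℕ) (ω₁ ω₂ : ℂ × ℂ → ℂ) : ℂ × ℂ → ℂ :=
  fun x => pd1 ω₂ x - pd2 ω₁ x
    + (m₂ : ℂ) * x.1 ^ (-(m₁ : ℤ)) * x.2 ^ (-(m₂ : ℤ) - 1) * ω₁ x
    - (m₁ : ℂ) * x.1 ^ (-(m₁ : ℤ) - 1) * x.2 ^ (-(m₂ : ℤ)) * ω₂ x

namespace CrossingDeRham

/-! ### Coefficient sequences -/

/-- Double sequences decaying faster than every geometric double sequence. -/
def decaying : Submodule ℂ (ℕ → ℕ → ℂ) where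
  carrier := {a | ∀ R : ℝ, 0 < R → ∃ C : ℝ, ∀ j k, ‖a j k‖ * R ^ (j + k) ≤ C}
  zero_mem' := fun R _ => ⟨0, fun j k => by simp⟩
  add_mem' := by
    intro a b ha hb R hR
    obtain ⟨C, hC⟩ := ha R hR
    obtain ⟨C', hC'⟩ := hb R hR
    refine ⟨C + C', fun j k => ?_⟩
    calc ‖a j k + b j k‖ * R ^ (j + k) ≤ (‖a j k‖ + ‖b j k‖) * R ^ (j + k) := by
          gcongr; exact norm_add_le _ _
      _ ≤ C + C' := by rw [add_mul]; exact add_le_add (hC j k) (hC' j k)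
  smul_mem' := by
    intro c a ha R hR
    obtain ⟨C, hC⟩ := ha R hR
    refine ⟨‖c‖ * C, fun j k => ?_⟩
    have : ‖(c • a) j k‖ = ‖c‖ * ‖a j k‖ := by simp
    rw [this, mul_assoc]
    exact mul_le_mul_of_nonneg_left (hC j k) (norm_nonneg _)

/-- Double sequences vanishing once both indices are large. -/
def cornerZero : Submodule ℂ (ℕ → ℕ → ℂ) where
  carrier := {a | ∃ N, ∀ j k, N ≤ j → N ≤ k → a j k = 0}
  zero_mem' := ⟨0, fun _ _ _ _ => rfl⟩
  add_mem' := by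
    rintro a b ⟨N, hN⟩ ⟨M, hM⟩
    refine ⟨max N M, fun j k hj hk => ?_⟩
    simp [hN j k (by omega) (by omega), hM j k (by omega) (by omega)]
  smul_mem' := by
    rintro c a ⟨N, hN⟩
    exact ⟨N, fun j k hj hk => by simp [hN j k hj hk]⟩

theorem decaying_of_norm_le {a b : ℕ → ℕ → ℂ} (hb : b ∈ decaying)
    (h : ∀ j k, ‖a j k‖ ≤ ‖b j k‖) : a ∈ decaying := by
  intro R hR
  obtain ⟨C, hC⟩ := hb R hR
  exact ⟨C, fun j k => (mul_le_mul_of_nonneg_right (h j k) (by positivity)).trans (hC j k)⟩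

/-- Translation by `(m₁, m₂)`, extended by zero. -/
def shift (m₁ m₂ : ℕ) (a : ℕ → ℕ → ℂ) : ℕ → ℕ → ℂ :=
  fun j k => if m₁ ≤ j ∧ m₂ ≤ k then a (j - m₁) (k - m₂) else 0

/-- The operator `z₁∂₁ - m₁ z₁^{-m₁}z₂^{-m₂}` on coefficients, up to sign. -/
def D₁ (m₁ m₂ : ℕ) (a : ℕ → ℕ → ℂ) : ℕ → ℕ → ℂ :=
  fun j k => (j : ℂ) * a j k + m₁ * shift m₁ m₂ a j k

/-- The operator `z₂∂₂ - m₂ z₁^{-m₁}z₂^{-m₂}` on coefficients, up to sign. -/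
def D₂ (m₁ m₂ : ℕ) (a : ℕ → ℕ → ℂ) : ℕ → ℕ → ℂ :=
  fun j k => (k : ℂ) * a j k + m₂ * shift m₁ m₂ a j k

theorem shift_mem_decaying {m₁ m₂ : ℕ} {a : ℕ → ℕ → ℂ} (ha : a ∈ decaying) :
    shift m₁ m₂ a ∈ decaying := by
  intro R hR
  obtain ⟨C, hC⟩ := ha R hR
  have hC0 : 0 ≤ C := le_trans (by positivity) (hC 0 0)
  refine ⟨C * R ^ (m₁ + m₂), fun j k => ?_⟩
  unfold shift
  split_ifs with h
  · have e : j + k = ((j - m₁) + (k - m₂)) + (m₁ + m₂) := by omega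
    rw [e, pow_add, ← mul_assoc]
    exact mul_le_mul_of_nonneg_right (hC _ _) (by positivity)
  · simp only [norm_zero, zero_mul]; positivity

theorem natCast_mul_mem_decaying {a : ℕ → ℕ → ℂ} (ha : a ∈ decaying) (e : ℕ → ℕ → ℕ)
    (he : ∀ j k, e j k ≤ j + k) : (fun j k => (e j k : ℂ) * a j k) ∈ decaying := by
  intro R hR
  obtain ⟨C, hC⟩ := ha (2 * R) (by positivity)
  refine ⟨C, fun j k => le_trans ?_ (hC j k)⟩
  have h2 : (e j k : ℝ) ≤ 2 ^ (j + k) := by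
    exact_mod_cast (he j k).trans (Nat.lt_two_pow_self).le
  simp only [norm_mul, Complex.norm_natCast, mul_pow]
  calc (e j k : ℝ) * ‖a j k‖ * R ^ (j + k) ≤ 2 ^ (j + k) * ‖a j k‖ * R ^ (j + k) := by gcongr
    _ = ‖a j k‖ * (2 ^ (j + k) * R ^ (j + k)) := by ring

theorem D₁_mem_decaying {m₁ m₂ : ℕ} {a : ℕ → ℕ → ℂ} (ha : a ∈ decaying) :
    D₁ m₁ m₂ a ∈ decaying :=
  decaying.add_mem (natCast_mul_mem_decaying ha (fun j _ => j) (by intros; omega))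
    (decaying.smul_mem (m₁ : ℂ) (shift_mem_decaying ha))

theorem D₂_mem_decaying {m₁ m₂ : ℕ} {a : ℕ → ℕ → ℂ} (ha : a ∈ decaying) :
    D₂ m₁ m₂ a ∈ decaying :=
  decaying.add_mem (natCast_mul_mem_decaying ha (fun _ k => k) (by intros; omega))
    (decaying.smul_mem (m₂ : ℂ) (shift_mem_decaying ha))

theorem shift_add (m₁ m₂ : ℕ) (a b : ℕ → ℕ → ℂ) :
    shift m₁ m₂ (a + b) = shift m₁ m₂ a + shift m₁ m₂ b := by
  ext j k; simp only [shift, Pi.add_apply]; split_ifs <;> simp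

theorem shift_smul (m₁ m₂ : ℕ) (c : ℂ) (a : ℕ → ℕ → ℂ) :
    shift m₁ m₂ (c • a) = c • shift m₁ m₂ a := by
  ext j k; simp only [shift, Pi.smul_apply]; split_ifs <;> simp

theorem D₁_add (m₁ m₂ : ℕ) (a b : ℕ → ℕ → ℂ) :
    D₁ m₁ m₂ (a + b) = D₁ m₁ m₂ a + D₁ m₁ m₂ b := by
  ext j k; simp only [D₁, shift_add, Pi.add_apply]; ring

theorem D₂_add (m₁ m₂ : ℕ) (a b : ℕ → ℕ → ℂ) :
    D₂ m₁ m₂ (a + b) = D₂ m₁ m₂ a + D₂ m₁ m₂ b := by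
  ext j k; simp only [D₂, shift_add, Pi.add_apply]; ring

theorem D₁_smul (m₁ m₂ : ℕ) (c : ℂ) (a : ℕ → ℕ → ℂ) :
    D₁ m₁ m₂ (c • a) = c • D₁ m₁ m₂ a := by
  ext j k; simp only [D₁, shift_smul, Pi.smul_apply, smul_eq_mul]; ring

theorem D₂_smul (m₁ m₂ : ℕ) (c : ℂ) (a : ℕ → ℕ → ℂ) :
    D₂ m₁ m₂ (c • a) = c • D₂ m₁ m₂ a := by
  ext j k; simp only [D₂, shift_smul, Pi.smul_apply, smul_eq_mul]; ring

theorem D₁_sub (m₁ m₂ : ℕ) (a b : ℕ → ℕ → ℂ) :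
    D₁ m₁ m₂ (a - b) = D₁ m₁ m₂ a - D₁ m₁ m₂ b := by
  rw [sub_eq_add_neg, ← neg_one_smul ℂ b, D₁_add, D₁_smul, neg_one_smul, sub_eq_add_neg]

theorem D₂_sub (m₁ m₂ : ℕ) (a b : ℕ → ℕ → ℂ) :
    D₂ m₁ m₂ (a - b) = D₂ m₁ m₂ a - D₂ m₁ m₂ b := by
  rw [sub_eq_add_neg, ← neg_one_smul ℂ b, D₂_add, D₂_smul, neg_one_smul, sub_eq_add_neg]

theorem D₂_mem_cornerZero {m₁ m₂ : ℕ} {a : ℕ → ℕ → ℂ} (ha : a ∈ cornerZero) :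
    D₂ m₁ m₂ a ∈ cornerZero := by
  obtain ⟨N, hN⟩ := ha
  refine ⟨N + m₁ + m₂, fun j k hj hk => ?_⟩
  simp [D₂, shift, hN j k (by omega) (by omega), hN (j - m₁) (k - m₂) (by omega) (by omega)]

theorem D₁_D₂_comm (m₁ m₂ : ℕ) (a : ℕ → ℕ → ℂ) :
    D₁ m₁ m₂ (D₂ m₁ m₂ a) = D₂ m₁ m₂ (D₁ m₁ m₂ a) := by
  ext j k
  by_cases h : m₁ ≤ j ∧ m₂ ≤ k
  · simp only [D₁, D₂, shift, h, and_self, if_true]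
    rw [Nat.cast_sub h.1, Nat.cast_sub h.2]
    ring
  · simp only [D₁, D₂, shift, h, if_false]
    ring

/-- A sequence satisfying a recursion with coefficients `m₁ / j` inherits the decay of the
inhomogeneous term. -/
theorem decaying_of_recursion {m₁ m₂ : ℕ} (hm₁ : 0 < m₁) {a b : ℕ → ℕ → ℂ} (hb : b ∈ decaying)
    (h : ∀ j k, ‖a j k‖ ≤ ‖b j k‖ +
      if m₁ ≤ j ∧ m₂ ≤ k then (m₁ / j : ℝ) * ‖a (j - m₁) (k - m₂)‖ else 0) :
    a ∈ decaying := by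
  intro R hR
  obtain ⟨B, hB⟩ := hb R hR
  have hB0 : 0 ≤ B := le_trans (by positivity) (hB 0 0)
  set K : ℝ := m₁ * R ^ (m₁ + m₂) with hK
  have hK0 : 0 ≤ K := by positivity
  obtain ⟨J, hJ⟩ := exists_nat_ge (2 * K)
  have step : ∀ j k, ‖a j k‖ * R ^ (j + k) ≤ B + if m₁ ≤ j ∧ m₂ ≤ k then
      (K / j) * (‖a (j - m₁) (k - m₂)‖ * R ^ ((j - m₁) + (k - m₂))) else 0 := by
    intro j k
    refine (mul_le_mul_of_nonneg_right (h j k) (by positivity)).trans ?_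
    rw [add_mul]
    refine add_le_add (hB j k) ?_
    split_ifs with hjk
    · have e : j + k = ((j - m₁) + (k - m₂)) + (m₁ + m₂) := by omega
      rw [e, pow_add, hK]
      apply le_of_eq
      ring
    · simp
  have small : ∀ j k, ‖a j k‖ * R ^ (j + k) ≤ B * (1 + K) ^ (j + 1) := by
    intro j
    induction j using Nat.strong_induction_on with
    | _ j ih =>
      intro k
      refine (step j k).trans ?_
      have h1 : 1 ≤ (1 + K) ^ j := one_le_pow₀ (by linarith)
      split_ifs with hjk
      · have hj : (1 : ℝ) ≤ j := by exact_mod_cast (by omega : 1 ≤ j)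
        have h2 : K / j ≤ K := div_le_self hK0 hj
        have h3 := ih (j - m₁) (by omega) (k - m₂)
        have h4 : (1 + K) ^ (j - m₁ + 1) ≤ (1 + K) ^ j :=
          pow_le_pow_right₀ (by linarith) (by omega)
        calc B + K / j * (‖a (j - m₁) (k - m₂)‖ * R ^ ((j - m₁) + (k - m₂)))
            ≤ B * (1 + K) ^ j + K * (B * (1 + K) ^ j) := by
              refine add_le_add (le_mul_of_one_le_right hB0 h1)
                (mul_le_mul h2 (h3.trans (mul_le_mul_of_nonneg_left h4 hB0)) (by positivity) hK0)
          _ = B * (1 + K) ^ (j + 1) := by ring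
      · rw [add_zero, pow_succ]
        exact le_mul_of_one_le_right hB0 (one_le_mul_of_one_le_of_one_le h1 (by linarith))
  set C := 2 * (B * (1 + K) ^ (J + 1)) with hC
  have hBC : B ≤ B * (1 + K) ^ (J + 1) :=
    le_mul_of_one_le_right hB0 (one_le_pow₀ (by linarith))
  refine ⟨C, fun j => ?_⟩
  induction j using Nat.strong_induction_on with
  | _ j ih =>
    intro k
    rcases le_total j J with hj | hj
    · refine (small j k).trans ?_
      have : B * (1 + K) ^ (j + 1) ≤ B * (1 + K) ^ (J + 1) := by
        gcongr
        linarith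
      linarith
    · refine (step j k).trans ?_
      split_ifs with hjk
      · have hj0 : (0 : ℝ) < j := by exact_mod_cast (by omega : 0 < j)
        have h2 : K / j ≤ 1 / 2 := by
          rw [div_le_div_iff₀ hj0 two_pos]
          have : (J : ℝ) ≤ j := by exact_mod_cast hj
          linarith
        have h3 := ih (j - m₁) (by omega) (k - m₂)
        have : K / j * (‖a (j - m₁) (k - m₂)‖ * R ^ ((j - m₁) + (k - m₂))) ≤ 1 / 2 * C := by
          gcongr
        linarith
      · linarith

/-- A solution of `D₁ a = b`, up to the row `j = 0`. -/
noncomputable def solveD₁ (m₁ m₂ : ℕ) (hm₁ : 0 < m₁) (b : ℕ → ℕ → ℂ) : ℕ → ℕ → ℂ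
  | j, k => if _h : m₁ ≤ j ∧ m₂ ≤ k then
      (b j k - m₁ * solveD₁ m₁ m₂ hm₁ b (j - m₁) (k - m₂)) / j
    else b j k / j
  termination_by j => j
  decreasing_by omega

theorem norm_div_natCast_le (x : ℂ) (j : ℕ) : ‖x / (j : ℂ)‖ ≤ ‖x‖ := by
  rcases Nat.eq_zero_or_pos j with rfl | hj
  · simp
  · rw [norm_div, Complex.norm_natCast]
    exact div_le_self (norm_nonneg _) (by exact_mod_cast hj)

theorem exists_D₁_sub_mem_cornerZero {m₁ m₂ : ℕ} (hm₁ : 0 < m₁) {b : ℕ → ℕ → ℂ}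
    (hb : b ∈ decaying) : ∃ a ∈ decaying, b - D₁ m₁ m₂ a ∈ cornerZero := by
  refine ⟨solveD₁ m₁ m₂ hm₁ b, decaying_of_recursion (m₂ := m₂) hm₁ hb fun j k => ?_,
    1, fun j k hj _ => ?_⟩
  · rw [solveD₁]
    split_ifs with h
    · rw [sub_div]
      refine (norm_sub_le _ _).trans (add_le_add (norm_div_natCast_le _ _) (le_of_eq ?_))
      rw [norm_div, norm_mul, Complex.norm_natCast, Complex.norm_natCast]
      ring
    · rw [add_zero]; exact norm_div_natCast_le _ _
  · have hj0 : (j : ℂ) ≠ 0 := by exact_mod_cast (by omega : j ≠ 0)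
    simp only [Pi.sub_apply, D₁, shift]
    rw [solveD₁]
    split_ifs with h
    · field_simp; ring
    · field_simp; ring

/-- The solution of `n W_n + d W_{n-d} = 0` for `n ≥ d` with `W_n = 1` for `n < d`. -/
noncomputable def lineWeight (d : ℕ) : ℕ → ℂ
  | n => if _h : 0 < d ∧ d ≤ n then -(d / n) * lineWeight d (n - d) else 1
  termination_by n => n
  decreasing_by omega

theorem lineWeight_of_le {d n : ℕ} (hd : 0 < d) (h : d ≤ n) :
    lineWeight d n = -(d / n) * lineWeight d (n - d) := by
  rw [lineWeight, dif_pos ⟨hd, h⟩]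

theorem lineWeight_ne_zero (d n : ℕ) : lineWeight d n ≠ 0 := by
  induction n using Nat.strong_induction_on with
  | _ n ih =>
    rw [lineWeight]
    split_ifs with h
    · refine mul_ne_zero (neg_ne_zero.mpr (div_ne_zero ?_ ?_)) (ih _ (by omega))
      · exact_mod_cast (by omega : d ≠ 0)
      · exact_mod_cast (by omega : n ≠ 0)
    · exact one_ne_zero

/-- The double sequence supported on the line through the origin in direction `(p, q)` whose
`n`-th value there is `c (n mod d) W_n`. -/
noncomputable def lineSeq {d : ℕ} (hd : 0 < d) (p q : ℕ) (c : Fin d → ℂ) : ℕ → ℕ → ℂ :=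
  fun j k => if p * k = q * j then c ⟨(j / p) % d, Nat.mod_lt _ hd⟩ * lineWeight d (j / p) else 0

theorem lineSeq_add {d : ℕ} (hd : 0 < d) (p q : ℕ) (c c' : Fin d → ℂ) :
    lineSeq hd p q (c + c') = lineSeq hd p q c + lineSeq hd p q c' := by
  ext j k; simp only [lineSeq, Pi.add_apply]; split_ifs <;> ring

theorem lineSeq_smul {d : ℕ} (hd : 0 < d) (p q : ℕ) (r : ℂ) (c : Fin d → ℂ) :
    lineSeq hd p q (r • c) = r • lineSeq hd p q c := by
  ext j k; simp only [lineSeq, Pi.smul_apply, smul_eq_mul]; split_ifs <;> ring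

theorem lineSeq_apply {d p : ℕ} (hd : 0 < d) (hp : 0 < p) (q : ℕ) (c : Fin d → ℂ) (n : ℕ) :
    lineSeq hd p q c (p * n) (q * n) = c ⟨n % d, Nat.mod_lt _ hd⟩ * lineWeight d n := by
  rw [lineSeq, if_pos (by ring)]
  simp [Nat.mul_div_cancel_left n hp]

theorem exists_eq_mul_of_coprime {p q j k : ℕ} (hp : 0 < p) (hpq : p.Coprime q)
    (h : p * k = q * j) : ∃ n, j = p * n ∧ k = q * n := by
  obtain ⟨n, rfl⟩ : p ∣ j := hpq.dvd_of_dvd_mul_left (h ▸ dvd_mul_right p k)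
  exact ⟨n, rfl, Nat.eq_of_mul_eq_mul_left hp (by rw [h]; ring)⟩

theorem D₂_sub_D₁ (d p q : ℕ) (a : ℕ → ℕ → ℂ) (j k : ℕ) :
    (p : ℂ) * D₂ (d * p) (d * q) a j k - q * D₁ (d * p) (d * q) a j k
      = ((p : ℂ) * k - q * j) * a j k := by
  simp only [D₁, D₂]; push_cast; ring

theorem mul_eq_mul_iff_shift {d p q j k : ℕ} (hj : d * p ≤ j) (hk : d * q ≤ k) :
    p * (k - d * q) = q * (j - d * p) ↔ p * k = q * j := by
  zify [hj, hk]
  constructor <;> intro h <;> linear_combination h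

theorem D₁_lineSeq {d p q : ℕ} (hd : 0 < d) (hp : 0 < p) (hpq : p.Coprime q) (c : Fin d → ℂ)
    {j k : ℕ} (hj : d * p ≤ j) (hk : d * q ≤ k) :
    D₁ (d * p) (d * q) (lineSeq hd p q c) j k = 0 := by
  by_cases h : p * k = q * j
  · obtain ⟨n, rfl, rfl⟩ := exists_eq_mul_of_coprime hp hpq h
    have hn : d ≤ n := by
      rw [mul_comm] at hj
      exact Nat.le_of_mul_le_mul_left hj hp
    have e1 : p * n - d * p = p * (n - d) := by rw [mul_comm d p, Nat.mul_sub]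
    have e2 : q * n - d * q = q * (n - d) := by rw [mul_comm d q, Nat.mul_sub]
    simp only [D₁, shift, hj, hk, and_self, if_true]
    rw [e1, e2, lineSeq_apply hd hp, lineSeq_apply hd hp, lineWeight_of_le hd hn]
    have hmod : (n - d) % d = n % d := (Nat.mod_eq_sub_mod hn).symm
    have hn0 : (n : ℂ) ≠ 0 := by exact_mod_cast (by omega : n ≠ 0)
    simp only [hmod]
    push_cast
    field_simp
    ring
  · have h' : ¬ p * (k - d * q) = q * (j - d * p) := by rwa [mul_eq_mul_iff_shift hj hk]
    simp [D₁, shift, lineSeq, h, h']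

theorem D₂_mem_cornerZero_of_D₁ {d p q : ℕ} (hp : 0 < p) {a : ℕ → ℕ → ℂ}
    (ha : ∀ j k, p * k ≠ q * j → a j k = 0) (h : D₁ (d * p) (d * q) a ∈ cornerZero) :
    D₂ (d * p) (d * q) a ∈ cornerZero := by
  obtain ⟨N, hN⟩ := h
  refine ⟨N, fun j k hj hk => ?_⟩
  have e := D₂_sub_D₁ d p q a j k
  rw [hN j k hj hk, mul_zero, sub_zero] at e
  have hp0 : (p : ℂ) ≠ 0 := by exact_mod_cast hp.ne'
  have : ((p : ℂ) * k - q * j) * a j k = 0 := by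
    by_cases hjk : p * k = q * j
    · have : (p : ℂ) * k = q * j := by exact_mod_cast hjk
      rw [this, sub_self, zero_mul]
    · rw [ha j k hjk, mul_zero]
  rw [this] at e
  exact (mul_eq_zero.mp e).resolve_left hp0

theorem D₁_lineSeq_mem {d p q : ℕ} (hd : 0 < d) (hp : 0 < p) (hpq : p.Coprime q)
    (c : Fin d → ℂ) : D₁ (d * p) (d * q) (lineSeq hd p q c) ∈ cornerZero :=
  ⟨d * p + d * q, fun _ _ hj hk => D₁_lineSeq hd hp hpq c (by omega) (by omega)⟩

theorem D₂_lineSeq_mem {d p q : ℕ} (hd : 0 < d) (hp : 0 < p) (hpq : p.Coprime q)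
    (c : Fin d → ℂ) : D₂ (d * p) (d * q) (lineSeq hd p q c) ∈ cornerZero :=
  D₂_mem_cornerZero_of_D₁ hp (fun j k h => by simp [lineSeq, h]) (D₁_lineSeq_mem hd hp hpq c)

theorem decaying_of_finite_support {a : ℕ → ℕ → ℂ} {M N : ℕ}
    (h : ∀ j k, ¬ (j < M ∧ k < N) → a j k = 0) : a ∈ decaying := by
  intro R hR
  refine ⟨∑ j ∈ Finset.range M, ∑ k ∈ Finset.range N, ‖a j k‖ * R ^ (j + k), fun j k => ?_⟩
  by_cases hjk : j < M ∧ k < N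
  · have h1 : ∀ j, 0 ≤ ∑ k ∈ Finset.range N, ‖a j k‖ * R ^ (j + k) :=
      fun j => Finset.sum_nonneg fun k _ => by positivity
    refine le_trans ?_ (Finset.single_le_sum (fun i _ => h1 i) (Finset.mem_range.mpr hjk.1))
    exact Finset.single_le_sum (f := fun k => ‖a j k‖ * R ^ (j + k))
      (fun i _ => by positivity) (Finset.mem_range.mpr hjk.2)
  · rw [h j k hjk, norm_zero, zero_mul]
    exact Finset.sum_nonneg fun j _ => Finset.sum_nonneg fun k _ => by positivity

theorem lineSeq_mem_decaying {d p q : ℕ} (hd : 0 < d) (hp : 0 < p) (hq : 0 < q)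
    (hpq : p.Coprime q) (c : Fin d → ℂ) : lineSeq hd p q c ∈ decaying := by
  refine decaying_of_recursion (m₁ := d * p) (m₂ := d * q) (by positivity)
    (b := fun j k => if j < d * p ∧ k < d * q then lineSeq hd p q c j k else 0)
    (decaying_of_finite_support (M := d * p) (N := d * q) fun j k h => if_neg h) fun j k => ?_
  by_cases h : d * p ≤ j ∧ d * q ≤ k
  · rw [if_pos h]
    have e := D₁_lineSeq hd hp hpq c h.1 h.2
    simp only [D₁, shift, h, and_self, if_true] at e
    have hj : (0 : ℝ) < j := by
      have : 0 < d * p := by positivity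
      exact_mod_cast (by omega : 0 < j)
    have e' : (j : ℝ) * ‖lineSeq hd p q c j k‖ =
        (d * p : ℕ) * ‖lineSeq hd p q c (j - d * p) (k - d * q)‖ := by
      rw [← Complex.norm_natCast, ← norm_mul, eq_neg_of_add_eq_zero_left e, norm_neg, norm_mul,
        Complex.norm_natCast]
    have : ‖lineSeq hd p q c j k‖ =
        ((d * p : ℕ) / j : ℝ) * ‖lineSeq hd p q c (j - d * p) (k - d * q)‖ := by
      field_simp
      linarith
    rw [this]
    exact le_add_of_nonneg_left (norm_nonneg _)
  · rw [if_neg h, add_zero]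
    by_cases hl : p * k = q * j
    · obtain ⟨n, rfl, rfl⟩ := exists_eq_mul_of_coprime hp hpq hl
      have hn : n < d := by
        by_contra hn
        push Not at hn
        exact h ⟨by rw [mul_comm]; exact Nat.mul_le_mul_left p hn,
          by rw [mul_comm]; exact Nat.mul_le_mul_left q hn⟩
      have h1 : p * n < d * p := by rw [mul_comm d]; exact Nat.mul_lt_mul_of_pos_left hn hp
      have h2 : q * n < d * q := by rw [mul_comm d]; exact Nat.mul_lt_mul_of_pos_left hn hq
      simp [h1, h2]
    · simp [lineSeq, hl]

theorem lineSeq_eventually {d p q : ℕ} (hd : 0 < d) (hp : 0 < p) {c : Fin d → ℂ}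
    {N : ℕ} (h : ∀ n, N ≤ n → lineSeq hd p q c (p * n) (q * n) = 0) : c = 0 := by
  ext r
  have h1 := h (r + d * N) (by nlinarith)
  rw [lineSeq_apply hd hp] at h1
  have h2 := (mul_eq_zero.mp h1).resolve_right (lineWeight_ne_zero _ _)
  have h3 : ((r : ℕ) + d * N) % d = r := by
    rw [Nat.add_mul_mod_self_left, Nat.mod_eq_of_lt r.2]
  simp only [h3] at h2
  exact h2

theorem eq_zero_of_lineSeq_sub_D₂_mem {d p q : ℕ} (hd : 0 < d) (hp : 0 < p) (hq : 0 < q)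
    {c : Fin d → ℂ} {a : ℕ → ℕ → ℂ} (h1 : D₁ (d * p) (d * q) a ∈ cornerZero)
    (h2 : lineSeq hd p q c - D₂ (d * p) (d * q) a ∈ cornerZero) : c = 0 := by
  obtain ⟨N, hN⟩ := h1
  obtain ⟨M, hM⟩ := h2
  have hp0 : (p : ℂ) ≠ 0 := by exact_mod_cast hp.ne'
  refine lineSeq_eventually (q := q) hd hp (N := N + M) fun n hn => ?_
  have i1 : n ≤ p * n := Nat.le_mul_of_pos_left n hp
  have i2 : n ≤ q * n := Nat.le_mul_of_pos_left n hq
  have e := D₂_sub_D₁ d p q a (p * n) (q * n)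
  rw [hN _ _ (by omega) (by omega)] at e
  have e2 : (p : ℂ) * D₂ (d * p) (d * q) a (p * n) (q * n) = 0 := by
    push_cast at e
    linear_combination e
  have e3 := hM (p * n) (q * n) (by omega) (by omega)
  rw [Pi.sub_apply, Pi.sub_apply, (mul_eq_zero.mp e2).resolve_left hp0, sub_zero] at e3
  exact e3

theorem eq_zero_of_lineSeq_mem {d p q : ℕ} (hd : 0 < d) (hp : 0 < p) (hq : 0 < q)
    {c : Fin d → ℂ} (h : lineSeq hd p q c ∈ cornerZero) : c = 0 := by
  obtain ⟨N, hN⟩ := h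
  exact lineSeq_eventually hd hp (N := N) fun n hn =>
    hN _ _ (hn.trans (Nat.le_mul_of_pos_left n hp)) (hn.trans (Nat.le_mul_of_pos_left n hq))

/-- The joint kernel of `D₁` and `D₂` modulo `cornerZero` is spanned by the sequences `lineSeq`. -/
theorem exists_sub_lineSeq_mem {d p q : ℕ} (hd : 0 < d) (hp : 0 < p) (hq : 0 < q)
    (hpq : p.Coprime q) {a : ℕ → ℕ → ℂ} (h1 : D₁ (d * p) (d * q) a ∈ cornerZero)
    (h2 : D₂ (d * p) (d * q) a ∈ cornerZero) :
    ∃ c : Fin d → ℂ, a - lineSeq hd p q c ∈ cornerZero := by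
  obtain ⟨N₁, hN₁⟩ := h1
  obtain ⟨N₂, hN₂⟩ := h2
  set N := N₁ + N₂ with hN
  have hp0 : (p : ℂ) ≠ 0 := by exact_mod_cast hp.ne'
  have off : ∀ j k, N ≤ j → N ≤ k → p * k ≠ q * j → a j k = 0 := by
    intro j k hj hk hjk
    have e := D₂_sub_D₁ d p q a j k
    rw [hN₁ j k (by omega) (by omega), hN₂ j k (by omega) (by omega)] at e
    have hne : (p : ℂ) * k - q * j ≠ 0 := by
      rw [sub_ne_zero]; exact_mod_cast hjk
    have e' : ((p : ℂ) * k - q * j) * a j k = 0 := by linear_combination -e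
    exact (mul_eq_zero.mp e').resolve_left hne
  set x : ℕ → ℂ := fun n => a (p * n) (q * n) / lineWeight d n with hx
  have per : ∀ n, N ≤ n → x (n + d) = x n := by
    intro n hn
    have i1 : n ≤ p * n := Nat.le_mul_of_pos_left n hp
    have i2 : n ≤ q * n := Nat.le_mul_of_pos_left n hq
    have e1 : p * (n + d) = p * n + d * p := by ring
    have e2 : q * (n + d) = q * n + d * q := by ring
    have e := hN₁ (p * (n + d)) (q * (n + d)) (by rw [e1]; omega) (by rw [e2]; omega)
    have h1 : d * p ≤ p * (n + d) := by rw [e1]; omega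
    have h2 : d * q ≤ q * (n + d) := by rw [e2]; omega
    simp only [D₁, shift, h1, h2, and_self, if_true] at e
    rw [show p * (n + d) - d * p = p * n by omega, show q * (n + d) - d * q = q * n by omega] at e
    have hW := lineWeight_ne_zero d n
    have hnd : ((n + d : ℕ) : ℂ) ≠ 0 := by exact_mod_cast (by omega : n + d ≠ 0)
    have hd0 : (d : ℂ) ≠ 0 := by exact_mod_cast hd.ne'
    simp only [hx]
    rw [lineWeight_of_le hd (Nat.le_add_left d n), Nat.add_sub_cancel]
    have e3 : ((n + d : ℕ) : ℂ) * a (p * (n + d)) (q * (n + d)) + d * a (p * n) (q * n) = 0 := by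
      apply mul_left_cancel₀ hp0
      push_cast at e ⊢
      linear_combination e
    rw [div_eq_div_iff (mul_ne_zero (neg_ne_zero.mpr (div_ne_zero hd0 hnd)) hW) hW]
    field_simp
    linear_combination e3
  have per' : ∀ r l, x (r + d * (N + l)) = x (r + d * N) := by
    intro r l
    induction l with
    | zero => simp
    | succ l ih =>
      rw [← ih, ← per (r + d * (N + l)) (by nlinarith)]
      congr 1
      ring
  refine ⟨fun r => x (r + d * N), (p + q) * (d * (N + 1)) + N, fun j k hj hk => ?_⟩
  have hj' : N ≤ j := by omega
  have hk' : N ≤ k := by omega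
  by_cases h : p * k = q * j
  · obtain ⟨n, rfl, rfl⟩ := exists_eq_mul_of_coprime hp hpq h
    have hn : d * N ≤ n := by
      by_contra hlt
      push Not at hlt
      have : p * n < p * (d * (N + 1)) :=
        Nat.mul_lt_mul_of_pos_left (hlt.trans_le (Nat.mul_le_mul_left d (by omega))) hp
      have h3 : p * (d * (N + 1)) ≤ (p + q) * (d * (N + 1)) :=
        Nat.mul_le_mul_right _ (by omega)
      omega
    rw [Pi.sub_apply, Pi.sub_apply, lineSeq_apply hd hp]
    obtain ⟨l, hl⟩ : ∃ l, n / d = N + l :=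
      Nat.exists_eq_add_of_le ((Nat.le_div_iff_mul_le hd).mpr (by rwa [mul_comm]))
    have e : n = n % d + d * (N + l) := by rw [← hl]; exact (Nat.mod_add_div n d).symm
    have e2 : x n = x (n % d + d * N) := by
      conv_lhs => rw [e]
      exact per' _ _
    change _ - x (n % d + d * N) * _ = 0
    rw [← e2]
    simp only [hx]
    rw [div_mul_cancel₀ _ (lineWeight_ne_zero d n), sub_self]
  · simp [off j k hj' hk' h, lineSeq, h]

/-- Every cocycle of the Koszul complex of `(D₁, D₂)` modulo `cornerZero` is cohomologous to one
of the form `(0, lineSeq c)`. -/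
theorem exists_cocycle_sub_mem {d p q : ℕ} (hd : 0 < d) (hp : 0 < p) (hq : 0 < q)
    (hpq : p.Coprime q) {a b : ℕ → ℕ → ℂ} (ha : a ∈ decaying) (hb : b ∈ decaying)
    (h : D₁ (d * p) (d * q) b - D₂ (d * p) (d * q) a ∈ cornerZero) :
    ∃ u ∈ decaying, ∃ c : Fin d → ℂ, a - D₁ (d * p) (d * q) u ∈ cornerZero ∧
      b - D₂ (d * p) (d * q) u - lineSeq hd p q c ∈ cornerZero := by
  obtain ⟨u₀, hu₀, hau₀⟩ := exists_D₁_sub_mem_cornerZero (m₁ := d * p) (m₂ := d * q)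
    (by positivity) ha
  set w := b - D₂ (d * p) (d * q) u₀ with hw
  have hwdec : w ∈ decaying := decaying.sub_mem hb (D₂_mem_decaying hu₀)
  have hDw : D₁ (d * p) (d * q) w ∈ cornerZero := by
    have : D₁ (d * p) (d * q) w = (D₁ (d * p) (d * q) b - D₂ (d * p) (d * q) a) +
        D₂ (d * p) (d * q) (a - D₁ (d * p) (d * q) u₀) := by
      rw [hw, D₁_sub, D₁_D₂_comm, D₂_sub]; abel
    rw [this]
    exact cornerZero.add_mem h (D₂_mem_cornerZero hau₀)
  set v : ℕ → ℕ → ℂ := fun j k => if p * k = q * j then 0 else w j k / ((p : ℂ) * k - q * j)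
    with hv
  set wl : ℕ → ℕ → ℂ := fun j k => if p * k = q * j then w j k else 0 with hwl
  have hvdec : v ∈ decaying := by
    refine decaying_of_norm_le hwdec fun j k => ?_
    simp only [hv]
    split_ifs with hjk
    · simp
    · rw [norm_div]
      refine div_le_self (norm_nonneg _) ?_
      have e : (p : ℂ) * k - q * j = (((p : ℤ) * k - q * j : ℤ) : ℂ) := by push_cast; ring
      rw [e, Complex.norm_intCast]
      have : (p : ℤ) * k - q * j ≠ 0 := by rw [sub_ne_zero]; exact_mod_cast hjk
      exact_mod_cast Int.one_le_abs this
  obtain ⟨N, hN⟩ := hDw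
  have hDv : D₁ (d * p) (d * q) v ∈ cornerZero := by
    refine ⟨N + d * p + d * q, fun j k hj hk => ?_⟩
    have hj' : d * p ≤ j := by omega
    have hk' : d * q ≤ k := by omega
    have e := hN j k (by omega) (by omega)
    simp only [D₁, shift, hj', hk', and_self, if_true] at e ⊢
    simp only [hv, mul_eq_mul_iff_shift hj' hk']
    split_ifs with hjk
    · simp
    · have e2 : (p : ℂ) * (k - d * q : ℕ) - q * (j - d * p : ℕ) = (p : ℂ) * k - q * j := by
        rw [Nat.cast_sub hj', Nat.cast_sub hk']; push_cast; ring
      rw [e2]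
      have hne : (p : ℂ) * k - q * j ≠ 0 := by
        rw [sub_ne_zero]; exact_mod_cast hjk
      linear_combination ((p : ℂ) * k - q * j)⁻¹ * e
  have hDwl : D₁ (d * p) (d * q) wl ∈ cornerZero := by
    refine ⟨N + d * p + d * q, fun j k hj hk => ?_⟩
    have hj' : d * p ≤ j := by omega
    have hk' : d * q ≤ k := by omega
    have e := hN j k (by omega) (by omega)
    simp only [D₁, shift, hj', hk', and_self, if_true] at e ⊢
    simp only [hwl, mul_eq_mul_iff_shift hj' hk']
    split_ifs with hjk
    · exact e
    · simp
  obtain ⟨c, hc⟩ := exists_sub_lineSeq_mem hd hp hq hpq hDwl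
    (D₂_mem_cornerZero_of_D₁ hp (fun j k hjk => if_neg hjk) hDwl)
  refine ⟨u₀ + (p : ℂ) • v, decaying.add_mem hu₀ (decaying.smul_mem _ hvdec), c, ?_, ?_⟩
  · rw [D₁_add, D₁_smul, ← sub_sub]
    exact cornerZero.sub_mem hau₀ (cornerZero.smul_mem _ hDv)
  · have e : b - D₂ (d * p) (d * q) (u₀ + (p : ℂ) • v) - lineSeq hd p q c =
        (wl - lineSeq hd p q c) - (q : ℂ) • D₁ (d * p) (d * q) v := by
      have key : w - (p : ℂ) • D₂ (d * p) (d * q) v = wl - (q : ℂ) • D₁ (d * p) (d * q) v := by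
        ext j k
        have e1 := D₂_sub_D₁ d p q v j k
        simp only [Pi.sub_apply, Pi.smul_apply, smul_eq_mul]
        have e2 : ((p : ℂ) * k - q * j) * v j k = w j k - wl j k := by
          simp only [hv, hwl]
          split_ifs with hjk
          · simp
          · have hne : (p : ℂ) * k - q * j ≠ 0 := by
              rw [sub_ne_zero]; exact_mod_cast hjk
            rw [mul_div_cancel₀ _ hne, sub_zero]
        linear_combination -e1 - e2
      rw [D₂_add, D₂_smul, ← sub_sub, ← hw, key]
      abel
    rw [e]
    exact cornerZero.sub_mem hc (cornerZero.smul_mem _ hDv)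

open Set Filter Topology Metric MeasureTheory

/-! ### Holomorphic functions of two variables and parameter integrals -/

theorem tendstoLocallyUniformlyOn_of_continuousOn {Y : Type*} [TopologicalSpace Y]
    {U : Set ℂ} {S : Set Y} {f : ℂ × Y → ℂ} (hf : ContinuousOn f (U ×ˢ S)) {s₀ : Y}
    (hs : s₀ ∈ S) :
    TendstoLocallyUniformlyOn (fun s w => f (w, s)) (fun w => f (w, s₀)) (𝓝[S] s₀) U := by
  rw [Metric.tendstoLocallyUniformlyOn_iff]
  intro ε hε x hx
  have h := hf (x, s₀) ⟨hx, hs⟩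
  rw [ContinuousWithinAt, nhdsWithin_prod_eq, Metric.tendsto_nhds] at h
  obtain ⟨t, ht, t', ht', htt⟩ := Filter.mem_prod_iff.1 (h (ε / 2) (by positivity))
  refine ⟨t, ht, ?_⟩
  filter_upwards [ht'] with s hs' y hy
  have h1 : dist (f (y, s)) (f (x, s₀)) < ε / 2 := htt ⟨hy, hs'⟩
  have h2 : dist (f (y, s₀)) (f (x, s₀)) < ε / 2 := htt ⟨hy, mem_of_mem_nhdsWithin hs ht'⟩
  have := dist_triangle_right (f (y, s₀)) (f (y, s)) (f (x, s₀))
  linarith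

/-- The derivative of a family of holomorphic functions depending continuously on a parameter is
jointly continuous. -/
theorem continuousOn_deriv_of_continuousOn {Y : Type*} [TopologicalSpace Y]
    {U : Set ℂ} (hU : IsOpen U) {S : Set Y} {f : ℂ × Y → ℂ} (hf : ContinuousOn f (U ×ˢ S))
    (hd : ∀ s ∈ S, DifferentiableOn ℂ (fun w => f (w, s)) U) :
    ContinuousOn (fun p : ℂ × Y => deriv (fun w => f (w, p.2)) p.1) (U ×ˢ S) := by
  rintro ⟨x, s₀⟩ ⟨hx, hs⟩
  have h1 := (tendstoLocallyUniformlyOn_of_continuousOn hf hs).deriv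
    (eventually_mem_nhdsWithin.mono fun s hs => hd s hs) hU
  have hc : ContinuousWithinAt (deriv fun w => f (w, s₀)) U x :=
    ((hd s₀ hs).deriv hU).continuousOn x hx
  rw [Metric.tendstoLocallyUniformlyOn_iff] at h1
  rw [ContinuousWithinAt, nhdsWithin_prod_eq, Metric.tendsto_nhds]
  intro ε hε
  obtain ⟨t, ht, hts⟩ := h1 (ε / 2) (by positivity) x hx
  have h2 : ∀ᶠ y in 𝓝[U] x, dist (deriv (fun w => f (w, s₀)) y) (deriv (fun w => f (w, s₀)) x)
      < ε / 2 := Metric.tendsto_nhds.1 hc (ε / 2) (by positivity)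
  have h3 : ∀ᶠ y in 𝓝[U] x, y ∈ t := ht
  filter_upwards [(h2.and h3).prod_mk hts] with p hp
  have h4 := hp.2 p.1 hp.1.2
  have h5 := hp.1.1
  simp only [Function.comp] at h4
  rw [dist_comm] at h4
  exact (dist_triangle _ _ _).trans_lt (by linarith)

/-- Osgood's lemma. -/
theorem differentiableOn_of_separately {U : Set (ℂ × ℂ)} (hU : IsOpen U) {f : ℂ × ℂ → ℂ}
    (hf : ContinuousOn f U) (h1 : ∀ z ∈ U, DifferentiableAt ℂ (fun w => f (w, z.2)) z.1)
    (h2 : ∀ z ∈ U, DifferentiableAt ℂ (fun w => f (z.1, w)) z.2) : DifferentiableOn ℂ f U := by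
  intro z hz
  obtain ⟨A, B, hA, hB, hzA, hzB, hAB⟩ := isOpen_prod_iff.1 hU z.1 z.2 hz
  have hc : ContinuousOn f (A ×ˢ B) := hf.mono hAB
  have hAB' : A ×ˢ B ∈ 𝓝 z := (hA.prod hB).mem_nhds ⟨hzA, hzB⟩
  have c1 : ContinuousAt (fun p : ℂ × ℂ => deriv (fun w => f (w, p.2)) p.1) z :=
    (continuousOn_deriv_of_continuousOn hA hc fun s hs w hw =>
      (h1 (w, s) (hAB ⟨hw, hs⟩)).differentiableWithinAt).continuousAt hAB'
  have c2 : ContinuousAt (fun p : ℂ × ℂ => deriv (fun w => f (p.1, w)) p.2) z := by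
    have h : ContinuousOn (fun p : ℂ × ℂ => deriv (fun w => f (p.2, w)) p.1) (B ×ˢ A) :=
      continuousOn_deriv_of_continuousOn (f := fun p => f (p.2, p.1)) hB
        (hc.comp continuous_swap.continuousOn fun p hp => ⟨hp.2, hp.1⟩)
        fun s hs w hw => (h2 (s, w) (hAB ⟨hs, hw⟩)).differentiableWithinAt
    have h' := h.continuousAt (x := (z.2, z.1)) ((hB.prod hA).mem_nhds ⟨hzB, hzA⟩)
    exact h'.comp (f := Prod.swap) (x := z) continuous_swap.continuousAt
  let L : ℂ → ℂ →L[ℂ] ℂ := fun c => ContinuousLinearMap.toSpanSingleton ℂ c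
  have hL : Continuous L := (ContinuousLinearMap.toSpanSingletonCLE (𝕜 := ℂ) (E := ℂ)).continuous
  have key := hasStrictFDerivAt_uncurry_coprod (𝕜 := ℂ) (u := z) (f := fun a b => f (a, b))
    (f₁ := fun a b => L (deriv (fun w => f (w, b)) a))
    (f₂ := fun a b => L (deriv (fun w => f (a, w)) b))
    (by
      filter_upwards [hU.mem_nhds hz] with v hv
      exact (h1 v hv).hasDerivAt.hasFDerivAt)
    (by
      filter_upwards [hU.mem_nhds hz] with v hv
      exact (h2 v hv).hasDerivAt.hasFDerivAt)
    (hL.continuousAt.comp c1) (hL.continuousAt.comp c2)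
  exact key.hasFDerivAt.differentiableAt.differentiableWithinAt

theorem continuousOn_circleIntegral {Y : Type*} [TopologicalSpace Y] [FirstCountableTopology Y]
    [LocallyCompactSpace Y]
    {U : Set Y} (hU : IsOpen U) {r : ℝ} (hr : 0 ≤ r) {K : Y → ℂ → ℂ}
    (hK : ContinuousOn (fun p : Y × ℂ => K p.1 p.2) (U ×ˢ sphere 0 r)) :
    ContinuousOn (fun y => ∮ ζ in C(0, r), K y ζ) U := by
  intro y hy
  refine ContinuousAt.continuousWithinAt ?_
  obtain ⟨T, hT, hTU, hTc⟩ := local_compact_nhds (hU.mem_nhds hy)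
  obtain ⟨C, hC⟩ := ((hTc.prod (isCompact_sphere (0 : ℂ) r)).exists_bound_of_continuousOn
    (hK.mono (prod_mono hTU subset_rfl)))
  have hs : ∀ θ : ℝ, circleMap 0 r θ ∈ sphere (0 : ℂ) r := fun θ => circleMap_mem_sphere 0 hr θ
  have hc : ∀ x ∈ U, Continuous fun θ => K x (circleMap 0 r θ) := fun x hx =>
    hK.comp_continuous (f := fun θ => (x, circleMap 0 r θ))
      (by fun_prop) fun θ => ⟨hx, hs θ⟩
  simp only [circleIntegral, deriv_circleMap]
  refine intervalIntegral.continuousAt_of_dominated_interval (bound := fun _ => r * C) ?_ ?_ ?_ ?_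
  · filter_upwards [hU.mem_nhds hy] with x hx
    have := hc x hx
    exact (((continuous_circleMap 0 r).mul continuous_const).fun_smul this).aestronglyMeasurable
  · filter_upwards [hT] with x hx
    refine Eventually.of_forall fun θ _ => ?_
    have := hC (x, circleMap 0 r θ) ⟨hx, hs θ⟩
    simp only [smul_eq_mul, norm_mul, norm_circleMap_zero, abs_of_nonneg hr, Complex.norm_I,
      mul_one]
    exact mul_le_mul_of_nonneg_left this hr
  · exact intervalIntegrable_const
  · refine Eventually.of_forall fun θ _ => ?_
    refine continuousAt_const.fun_smul ?_
    have : ContinuousOn (fun x => K x (circleMap 0 r θ)) U :=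
      hK.comp (f := fun x => (x, circleMap 0 r θ)) (by fun_prop) fun x hx => ⟨hx, hs θ⟩
    exact this.continuousAt (hU.mem_nhds hy)

theorem differentiableOn_circleIntegral {U : Set ℂ} (hU : IsOpen U) {r : ℝ} (hr : 0 ≤ r)
    {K : ℂ → ℂ → ℂ} (hK : ContinuousOn (fun p : ℂ × ℂ => K p.1 p.2) (U ×ˢ sphere 0 r))
    (hd : ∀ ζ ∈ sphere (0 : ℂ) r, DifferentiableOn ℂ (fun w => K w ζ) U) :
    DifferentiableOn ℂ (fun w => ∮ ζ in C(0, r), K w ζ) U := by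
  intro w hw
  have hK' := continuousOn_deriv_of_continuousOn hU hK hd
  obtain ⟨T, hT, hTU, hTc⟩ := local_compact_nhds (hU.mem_nhds hw)
  obtain ⟨C, hC⟩ := ((hTc.prod (isCompact_sphere (0 : ℂ) r)).exists_bound_of_continuousOn
    (hK'.mono (prod_mono hTU subset_rfl)))
  have hs : ∀ θ : ℝ, circleMap 0 r θ ∈ sphere (0 : ℂ) r := fun θ => circleMap_mem_sphere 0 hr θ
  have hc : ∀ x ∈ U, Continuous fun θ => deriv (circleMap 0 r) θ • K x (circleMap 0 r θ) := by
    intro x hx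
    have := hK.comp_continuous (f := fun θ => (x, circleMap 0 r θ))
      (by fun_prop) fun θ => ⟨hx, hs θ⟩
    simp only [deriv_circleMap]
    exact ((continuous_circleMap 0 r).mul continuous_const).fun_smul this
  refine DifferentiableAt.differentiableWithinAt ?_
  simp only [circleIntegral]
  refine (intervalIntegral.hasDerivAt_integral_of_dominated_loc_of_deriv_le
    (F' := fun x θ => deriv (circleMap 0 r) θ • deriv (fun w => K w (circleMap 0 r θ)) x)
    (bound := fun _ => r * C) hT ?_ ?_ ?_ ?_ ?_ ?_).2.differentiableAt
  · filter_upwards [hU.mem_nhds hw] with x hx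
    exact (hc x hx).aestronglyMeasurable
  · exact (hc w hw).intervalIntegrable _ _
  · have := hK'.comp_continuous (f := fun θ => (w, circleMap 0 r θ))
      (by fun_prop) fun θ => ⟨hw, hs θ⟩
    simp only [deriv_circleMap]
    exact Continuous.aestronglyMeasurable (by fun_prop)
  · refine Eventually.of_forall fun θ _ x hx => ?_
    have := hC (x, circleMap 0 r θ) ⟨hx, hs θ⟩
    simp only [smul_eq_mul, norm_mul, deriv_circleMap, norm_circleMap_zero, abs_of_nonneg hr,
      Complex.norm_I, mul_one]
    exact mul_le_mul_of_nonneg_left this hr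
  · exact intervalIntegrable_const
  · refine Eventually.of_forall fun θ _ x hx => ?_
    exact ((hd _ (hs θ)).differentiableAt (hU.mem_nhds (hTU hx))).hasDerivAt.fun_const_smul _

theorem differentiableOn_circleIntegral₂ {U : Set (ℂ × ℂ)} (hU : IsOpen U) {r : ℝ} (hr : 0 ≤ r)
    {K : ℂ × ℂ → ℂ → ℂ} (hK : ContinuousOn (fun p : (ℂ × ℂ) × ℂ => K p.1 p.2) (U ×ˢ sphere 0 r))
    (hd : ∀ ζ ∈ sphere (0 : ℂ) r, DifferentiableOn ℂ (fun z => K z ζ) U) :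
    DifferentiableOn ℂ (fun z => ∮ ζ in C(0, r), K z ζ) U := by
  refine differentiableOn_of_separately hU (continuousOn_circleIntegral hU hr hK) ?_ ?_
  · rintro ⟨z, s⟩ hz
    have hV : IsOpen ((fun w : ℂ => (w, s)) ⁻¹' U) := hU.preimage (by fun_prop)
    refine (differentiableOn_circleIntegral hV hr (K := fun w ζ => K (w, s) ζ) ?_ ?_
      ).differentiableAt (hV.mem_nhds hz)
    · exact hK.comp (f := fun p : ℂ × ℂ => ((p.1, s), p.2)) (by fun_prop)
        fun p hp => ⟨hp.1, hp.2⟩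
    · intro ζ hζ
      exact (hd ζ hζ).comp (f := fun w => (w, s)) (by fun_prop) fun w hw => hw
  · rintro ⟨s, z⟩ hz
    have hV : IsOpen ((fun w : ℂ => (s, w)) ⁻¹' U) := hU.preimage (by fun_prop)
    refine (differentiableOn_circleIntegral hV hr (K := fun w ζ => K (s, w) ζ) ?_ ?_
      ).differentiableAt (hV.mem_nhds hz)
    · exact hK.comp (f := fun p : ℂ × ℂ => ((s, p.1), p.2)) (by fun_prop)
        fun p hp => ⟨hp.1, hp.2⟩
    · intro ζ hζ
      exact (hd ζ hζ).comp (f := fun w => (s, w)) (by fun_prop) fun w hw => hw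

theorem differentiableOn_pd1 {U : Set (ℂ × ℂ)} (hU : IsOpen U) {g : ℂ × ℂ → ℂ}
    (hg : DifferentiableOn ℂ g U) : DifferentiableOn ℂ (pd1 g) U := by
  intro z₀ hz₀
  obtain ⟨r, hr, hrU⟩ := Metric.isOpen_iff.1 hU z₀ hz₀
  have hmem : ∀ z ∈ ball z₀ (r / 2), ∀ ζ ∈ closedBall (0 : ℂ) (r / 2), (z.1 + ζ, z.2) ∈ U := by
    intro z hz ζ hζ
    apply hrU
    rw [mem_ball, Prod.dist_eq, max_lt_iff] at hz ⊢
    rw [mem_closedBall, dist_zero_right] at hζ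
    refine ⟨?_, by dsimp only; linarith [hz.2]⟩
    calc dist (z.1 + ζ) z₀.1 ≤ dist (z.1 + ζ) z.1 + dist z.1 z₀.1 := dist_triangle _ _ _
      _ < r := by rw [dist_self_add_left]; linarith [hz.1]
  have hmaps : ∀ ζ ∈ closedBall (0 : ℂ) (r / 2),
      MapsTo (fun z : ℂ × ℂ => (z.1 + ζ, z.2)) (ball z₀ (r / 2)) U := fun ζ hζ z hz =>
    hmem z hz ζ hζ
  have key : DifferentiableOn ℂ (fun z : ℂ × ℂ => (2 * Real.pi * Complex.I : ℂ)⁻¹ •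
      ∮ ζ in C(0, r / 2), ((ζ - 0) ^ 2)⁻¹ • g (z.1 + ζ, z.2)) (ball z₀ (r / 2)) := by
    refine (differentiableOn_circleIntegral₂ isOpen_ball (by positivity) ?_ ?_).const_smul (2 * Real.pi * Complex.I : ℂ)⁻¹
    · refine ContinuousOn.fun_smul (f := fun p : (ℂ × ℂ) × ℂ => ((p.2 - 0) ^ 2)⁻¹)
        (g := fun p : (ℂ × ℂ) × ℂ => g (p.1.1 + p.2, p.1.2)) ?_ ?_
      · refine ContinuousOn.inv₀ (by fun_prop) ?_
        rintro ⟨z, ζ⟩ ⟨_, hζ⟩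
        have : ζ ≠ 0 := ne_of_mem_sphere hζ (by positivity)
        simpa using this
      · exact hg.continuousOn.comp (f := fun p : (ℂ × ℂ) × ℂ => (p.1.1 + p.2, p.1.2))
          (by fun_prop) fun p hp => hmem _ hp.1 _ (sphere_subset_closedBall hp.2)
    · intro ζ hζ
      refine DifferentiableOn.fun_const_smul ?_ _
      exact hg.comp (f := fun z : ℂ × ℂ => (z.1 + ζ, z.2)) (by fun_prop)
        (hmaps ζ (sphere_subset_closedBall hζ))
  refine ((key.congr ?_).differentiableAt
    (ball_mem_nhds z₀ (by positivity))).differentiableWithinAt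
  intro z hz
  have hV : IsOpen ((fun w : ℂ => (z.1 + w, z.2)) ⁻¹' U) := hU.preimage (by fun_prop)
  rw [Complex.two_pi_I_inv_smul_circleIntegral_sub_sq_inv_smul_of_differentiable hV
    (fun ζ hζ => hmem z hz ζ hζ) (f := fun w => g (z.1 + w, z.2))
    (hg.comp (f := fun w => (z.1 + w, z.2)) (by fun_prop) fun w hw => hw)
    (mem_ball_self (by positivity)), deriv_comp_const_add (f := fun w => g (w, z.2)), add_zero, pd1]

theorem pd2_eq_pd1_swap (g : ℂ × ℂ → ℂ) (z : ℂ × ℂ) : pd2 g z = pd1 (g ∘ Prod.swap) z.swap := rfl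

theorem differentiableOn_pd2 {U : Set (ℂ × ℂ)} (hU : IsOpen U) {g : ℂ × ℂ → ℂ}
    (hg : DifferentiableOn ℂ g U) : DifferentiableOn ℂ (pd2 g) U := by
  have hs : Differentiable ℂ (Prod.swap : ℂ × ℂ → ℂ × ℂ) := differentiable_snd.prodMk differentiable_fst
  have h := differentiableOn_pd1 (hU.preimage continuous_swap)
    (hg.comp (f := Prod.swap) hs.differentiableOn fun z hz => hz)
  exact h.comp (f := Prod.swap) hs.differentiableOn fun z hz => by simpa using hz

theorem differentiableAt_slice_fst {U : Set (ℂ × ℂ)} (hU : IsOpen U) {g : ℂ × ℂ → ℂ}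
    (hg : DifferentiableOn ℂ g U) {z : ℂ × ℂ} (hz : z ∈ U) :
    DifferentiableAt ℂ (fun w => g (w, z.2)) z.1 :=
  DifferentiableAt.comp (f := fun w => (w, z.2)) z.1 (hg.differentiableAt (hU.mem_nhds hz))
    (by fun_prop)

theorem differentiableAt_slice_snd {U : Set (ℂ × ℂ)} (hU : IsOpen U) {g : ℂ × ℂ → ℂ}
    (hg : DifferentiableOn ℂ g U) {z : ℂ × ℂ} (hz : z ∈ U) :
    DifferentiableAt ℂ (fun w => g (z.1, w)) z.2 :=
  DifferentiableAt.comp (f := fun w => (z.1, w)) z.2 (hg.differentiableAt (hU.mem_nhds hz))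
    (by fun_prop)

/-! ### Circle integrals and series -/

theorem hasSum_of_eq {ι : Type*} {F F' : ι → ℂ} {s s' : ℂ} (h : HasSum F s)
    (hF : ∀ i, F' i = F i) (hs : s' = s) : HasSum F' s' := by
  rwa [funext hF, hs]

theorem hasSum_circleIntegral {ι : Type*} [Countable ι] {r : ℝ} (hr : 0 ≤ r) {F : ι → ℂ → ℂ}
    {G : ℂ → ℂ} {u : ι → ℝ} (hu : Summable u) (hF : ∀ i, ContinuousOn (F i) (sphere 0 r))
    (hFu : ∀ i, ∀ ζ ∈ sphere (0 : ℂ) r, ‖F i ζ‖ ≤ u i)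
    (hG : ∀ ζ ∈ sphere (0 : ℂ) r, HasSum (fun i => F i ζ) (G ζ)) :
    HasSum (fun i => ∮ ζ in C(0, r), F i ζ) (∮ ζ in C(0, r), G ζ) := by
  have hs : ∀ θ : ℝ, circleMap 0 r θ ∈ sphere (0 : ℂ) r := fun θ => circleMap_mem_sphere 0 hr θ
  simp only [circleIntegral, deriv_circleMap]
  refine intervalIntegral.hasSum_integral_of_dominated_convergence (fun i _ => r * u i) ?_ ?_ ?_ ?_
    ?_
  · intro i
    have h := (hF i).comp_continuous (continuous_circleMap 0 r) hs
    exact (((continuous_circleMap 0 r).mul continuous_const).fun_smul h).aestronglyMeasurable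
  · refine fun i => Eventually.of_forall fun θ _ => ?_
    simp only [smul_eq_mul, norm_mul, norm_circleMap_zero, abs_of_nonneg hr, Complex.norm_I,
      mul_one]
    exact mul_le_mul_of_nonneg_left (hFu i _ (hs θ)) hr
  · exact Eventually.of_forall fun θ _ => hu.mul_left r
  · exact intervalIntegrable_const
  · exact Eventually.of_forall fun θ _ => (hG _ (hs θ)).const_smul _

theorem circleIntegral_pow_mul_inv_pow {r : ℝ} (hr : 0 < r) (K k : ℕ) :
    (∮ ζ in C(0, r), ζ ^ K * ζ⁻¹ ^ k) = if k = K + 1 then (2 * Real.pi * Complex.I : ℂ) else 0 := by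
  have h : (∮ ζ in C(0, r), ζ ^ K * ζ⁻¹ ^ k) = ∮ ζ in C(0, r), (ζ - 0) ^ ((K : ℤ) - k) := by
    refine circleIntegral.integral_congr hr.le fun ζ hζ => ?_
    have : ζ ≠ 0 := ne_of_mem_sphere hζ hr.ne'
    simp only [sub_zero]
    rw [zpow_sub₀ this, inv_pow, div_eq_mul_inv, zpow_natCast, zpow_natCast]
  rw [h]
  split_ifs with hk
  · rw [← circleIntegral.integral_sub_center_inv 0 hr.ne']
    congr 1; ext ζ
    rw [hk, ← zpow_neg_one]; congr 1; push_cast; ring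
  · exact circleIntegral.integral_sub_zpow_of_ne (by omega) _ _ _

/-- A function holomorphic on a punctured disc has the same integral over all small circles. -/
theorem circleIntegral_eq_of_punctured {g : ℂ → ℂ} {R ε ρ : ℝ} (hε : 0 < ε) (hερ : ε ≤ ρ)
    (hρ : ρ < R) (hg : ∀ w, w ≠ 0 → ‖w‖ < R → DifferentiableAt ℂ g w) :
    (∮ ζ in C(0, ρ), g ζ) = ∮ ζ in C(0, ε), g ζ := by
  have hd : ∀ z ∈ closedBall (0 : ℂ) ρ \ ball 0 ε, DifferentiableAt ℂ g z := by
    rintro z ⟨h1, h2⟩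
    rw [mem_closedBall, dist_zero_right] at h1
    rw [mem_ball, dist_zero_right, not_lt] at h2
    exact hg z (norm_pos_iff.1 (hε.trans_le h2)) (by linarith)
  exact Complex.circleIntegral_eq_of_differentiable_on_annulus_off_countable hε hερ
    countable_empty (fun z hz => (hd z hz).continuousAt.continuousWithinAt)
    fun z hz => hd z ⟨ball_subset_closedBall hz.1.1, fun h => hz.1.2 (ball_subset_closedBall h)⟩

/-- Cauchy's integral formula on an annulus. -/
theorem annulus_cauchy {g : ℂ → ℂ} {R ε ρ : ℝ} {z : ℂ} (hε : 0 < ε) (hεz : ε < ‖z‖)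
    (hzρ : ‖z‖ < ρ) (hρ : ρ < R) (hg : ∀ w, w ≠ 0 → ‖w‖ < R → DifferentiableAt ℂ g w) :
    (∮ ζ in C(0, ρ), (ζ - z)⁻¹ * g ζ) - (∮ ζ in C(0, ε), (ζ - z)⁻¹ * g ζ)
      = 2 * Real.pi * Complex.I * g z := by
  have hz0 : z ≠ 0 := norm_pos_iff.1 (hε.trans hεz)
  have hgz : DifferentiableAt ℂ g z := hg z hz0 (hzρ.trans hρ)
  have hd : ∀ w, w ≠ 0 → ‖w‖ < R → w ≠ z → DifferentiableAt ℂ (dslope g z) w := fun w h0 h1 h2 =>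
    (differentiableAt_dslope_of_ne h2).2 (hg w h0 h1)
  have hcont : ∀ w, w ≠ 0 → ‖w‖ < R → ContinuousAt (dslope g z) w := by
    intro w h0 h1
    rcases eq_or_ne w z with rfl | h
    · exact continuousAt_dslope_same.2 hgz
    · exact (hd w h0 h1 h).continuousAt
  have hann : ∀ w ∈ closedBall (0 : ℂ) ρ \ ball 0 ε, w ≠ 0 ∧ ‖w‖ < R := by
    rintro w ⟨h1, h2⟩
    rw [mem_closedBall, dist_zero_right] at h1
    rw [mem_ball, dist_zero_right, not_lt] at h2
    exact ⟨norm_pos_iff.1 (hε.trans_le h2), by linarith⟩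
  have h1 := Complex.circleIntegral_eq_of_differentiable_on_annulus_off_countable hε
    (hεz.trans hzρ).le (countable_singleton z) (f := dslope g z)
    (fun w hw => (hcont w (hann w hw).1 (hann w hw).2).continuousWithinAt)
    fun w hw => by
      have := hann w ⟨ball_subset_closedBall hw.1.1, fun h => hw.1.2 (ball_subset_closedBall h)⟩
      exact hd w this.1 this.2 hw.2
  have h2 : ∀ t : ℝ, 0 < t → t < R → t ≠ ‖z‖ → (∮ ζ in C(0, t), dslope g z ζ)
      = (∮ ζ in C(0, t), (ζ - z)⁻¹ * g ζ) - (∮ ζ in C(0, t), (ζ - z)⁻¹) * g z := by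
    intro t ht htR htz
    have hne : ∀ ζ ∈ sphere (0 : ℂ) t, ζ ≠ z := by
      rintro ζ hζ rfl
      exact htz (by simpa using hζ.symm)
    have hi : ContinuousOn (fun ζ => (ζ - z)⁻¹) (sphere 0 t) :=
      ContinuousOn.inv₀ (by fun_prop) fun ζ hζ => sub_ne_zero.2 (hne ζ hζ)
    have hgc : ContinuousOn g (sphere 0 t) := fun ζ hζ =>
      (hg ζ (ne_of_mem_sphere hζ ht.ne') (by
        rw [mem_sphere, dist_zero_right] at hζ; linarith)).continuousAt.continuousWithinAt
    have h3 : (∮ ζ in C(0, t), (ζ - z)⁻¹) * g z = ∮ ζ in C(0, t), (ζ - z)⁻¹ * g z :=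
      (circleIntegral.integral_smul_const _ _ _ _).symm
    rw [h3, ← circleIntegral.integral_sub ((hi.fun_mul hgc).circleIntegrable ht.le)
      ((hi.fun_mul continuousOn_const).circleIntegrable ht.le)]
    refine circleIntegral.integral_congr ht.le fun ζ hζ => ?_
    simp only [dslope_of_ne g (hne ζ hζ), slope, vsub_eq_sub, smul_eq_mul]
    ring
  have hρ0 : 0 < ρ := by linarith
  rw [h2 ρ hρ0 hρ hzρ.ne', h2 ε hε (by linarith) hεz.ne,
    circleIntegral.integral_sub_inv_of_mem_ball (by simpa using hzρ)] at h1
  have h4 : (∮ ζ in C(0, ε), (ζ - z)⁻¹) = 0 := by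
    have hne : ∀ ζ ∈ closedBall (0 : ℂ) ε, ζ - z ≠ 0 := by
      intro ζ hζ h
      rw [sub_eq_zero.1 h, mem_closedBall, dist_zero_right] at hζ
      linarith
    refine Complex.circleIntegral_eq_zero_of_differentiable_on_off_countable hε.le
      countable_empty (ContinuousOn.inv₀ (by fun_prop) hne) fun w hw => ?_
    exact DifferentiableAt.inv (by fun_prop) (hne w (ball_subset_closedBall hw.1))
  rw [h4] at h1
  linear_combination h1

/-- Expansion of the principal part of a function holomorphic on a punctured disc. -/
theorem hasSum_principalPart {g : ℂ → ℂ} {R ε ρ : ℝ} {z : ℂ} (hε : 0 < ε) (hεz : ε < ‖z‖)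
    (hzρ : ‖z‖ < ρ) (hρ : ρ < R) (hg : ∀ w, w ≠ 0 → ‖w‖ < R → DifferentiableAt ℂ g w) :
    HasSum (fun k => ((2 * Real.pi * Complex.I : ℂ)⁻¹ * ∮ ζ in C(0, ε), ζ ^ k * g ζ)
        * z⁻¹ ^ (k + 1))
      (g z - (2 * Real.pi * Complex.I : ℂ)⁻¹ * ∮ ζ in C(0, ρ), (ζ - z)⁻¹ * g ζ) := by
  have hz0 : z ≠ 0 := norm_pos_iff.1 (hε.trans hεz)
  have hgc : ContinuousOn g (sphere 0 ε) := fun ζ hζ =>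
    (hg ζ (ne_of_mem_sphere hζ hε.ne') (by
      rw [mem_sphere, dist_zero_right] at hζ; linarith)).continuousAt.continuousWithinAt
  obtain ⟨C, hC⟩ := (isCompact_sphere (0 : ℂ) ε).exists_bound_of_continuousOn hgc
  have hq : ε / ‖z‖ < 1 := (div_lt_one (hε.trans hεz)).2 hεz
  have h1 := hasSum_circleIntegral (ι := ℕ) hε.le (F := fun k ζ => z⁻¹ ^ (k + 1) * (ζ ^ k * g ζ))
    (G := fun ζ => -((ζ - z)⁻¹ * g ζ)) (u := fun k => (ε / ‖z‖) ^ k * (‖z‖⁻¹ * C))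
    ((summable_geometric_of_lt_one (by positivity) hq).mul_right _)
    (fun k => by fun_prop)
    (fun k ζ hζ => by
      have h := hC ζ hζ
      rw [mem_sphere, dist_zero_right] at hζ
      rw [norm_mul, norm_mul, norm_pow, norm_pow, norm_inv, hζ]
      calc ‖z‖⁻¹ ^ (k + 1) * (ε ^ k * ‖g ζ‖) = (ε / ‖z‖) ^ k * (‖z‖⁻¹ * ‖g ζ‖) := by
            rw [div_pow, pow_succ, inv_pow]; ring
        _ ≤ _ := by gcongr)
    (fun ζ hζ => by
      rw [mem_sphere, dist_zero_right] at hζ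
      have h2 : ‖ζ / z‖ < 1 := by rwa [norm_div, hζ]
      have h3 := (hasSum_geometric_of_norm_lt_one h2).mul_right (z⁻¹ * g ζ)
      have hne : ζ - z ≠ 0 := sub_ne_zero.2 fun h => by rw [← h, hζ] at hεz; exact hεz.false
      refine hasSum_of_eq h3 (fun k => ?_) ?_
      · rw [div_pow, pow_succ, inv_pow]; ring
      · have : 1 - ζ / z = -(ζ - z) / z := by field_simp; ring
        rw [this]
        field_simp)
  have h5 := annulus_cauchy hε hεz hzρ hρ hg
  have hpi : (2 * Real.pi * Complex.I : ℂ) ≠ 0 := Complex.two_pi_I_ne_zero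
  refine hasSum_of_eq (h1.mul_left (2 * Real.pi * Complex.I : ℂ)⁻¹) (fun k => ?_) ?_
  · rw [circleIntegral.integral_const_mul]; ring
  · have h6 : (∮ ζ in C(0, ε), -((ζ - z)⁻¹ * g ζ)) = -∮ ζ in C(0, ε), (ζ - z)⁻¹ * g ζ := by
      have := circleIntegral.integral_const_mul (-1) (fun ζ => (ζ - z)⁻¹ * g ζ) 0 ε
      simpa using this
    rw [h6, ← sub_eq_zero, ← mul_right_inj' hpi, mul_sub, mul_sub, mul_inv_cancel_left₀ hpi,
      mul_inv_cancel_left₀ hpi]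
    linear_combination -h5

/-! ### Entire double power series with rapidly decaying coefficients -/

/-- The double power series with coefficients `a`. -/
noncomputable def entireSum (a : ℕ → ℕ → ℂ) (w : ℂ × ℂ) : ℂ :=
  ∑' p : ℕ × ℕ, a p.1 p.2 * (w.1 ^ p.1 * w.2 ^ p.2)

theorem exists_summable_bound {a : ℕ → ℕ → ℂ} (ha : a ∈ decaying) (M : ℝ) :
    ∃ u : ℕ × ℕ → ℝ, Summable u ∧ ∀ w : ℂ × ℂ, ‖w.1‖ ≤ M → ‖w.2‖ ≤ M →
      ∀ p : ℕ × ℕ, ‖a p.1 p.2 * (w.1 ^ p.1 * w.2 ^ p.2)‖ ≤ u p := by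
  obtain ⟨C, hC⟩ := ha (2 * (|M| + 1)) (by positivity)
  refine ⟨fun p => C * ((1 / 2) ^ p.1 * (1 / 2) ^ p.2), ?_, fun w h1 h2 p => ?_⟩
  · have h : Summable fun n : ℕ => (1 / 2 : ℝ) ^ n :=
      summable_geometric_of_lt_one (by norm_num) (by norm_num)
    exact (h.mul_of_nonneg h (fun _ => by positivity) (fun _ => by positivity)).mul_left C
  · have h3 : ∀ x : ℂ, ‖x‖ ≤ M → ‖x‖ ≤ |M| + 1 := fun x hx => hx.trans (by
      linarith [le_abs_self M])
    rw [norm_mul, norm_mul, norm_pow, norm_pow]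
    calc ‖a p.1 p.2‖ * (‖w.1‖ ^ p.1 * ‖w.2‖ ^ p.2)
        ≤ ‖a p.1 p.2‖ * ((|M| + 1) ^ p.1 * (|M| + 1) ^ p.2) := by
          gcongr
          exacts [h3 _ h1, h3 _ h2]
      _ = ‖a p.1 p.2‖ * (2 * (|M| + 1)) ^ (p.1 + p.2) * ((1 / 2) ^ p.1 * (1 / 2) ^ p.2) := by
          rw [pow_add, mul_pow, mul_pow, div_pow, div_pow, one_pow, one_pow]
          field_simp
      _ ≤ C * ((1 / 2) ^ p.1 * (1 / 2) ^ p.2) :=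
          mul_le_mul_of_nonneg_right (hC _ _) (by positivity)

theorem hasSum_entireSum {a : ℕ → ℕ → ℂ} (ha : a ∈ decaying) (w : ℂ × ℂ) :
    HasSum (fun p : ℕ × ℕ => a p.1 p.2 * (w.1 ^ p.1 * w.2 ^ p.2)) (entireSum a w) := by
  obtain ⟨u, hu, h⟩ := exists_summable_bound ha (max ‖w.1‖ ‖w.2‖)
  exact (Summable.of_norm_bounded hu (h w (le_max_left _ _) (le_max_right _ _))).hasSum

theorem entireSum_add {a b : ℕ → ℕ → ℂ} (ha : a ∈ decaying) (hb : b ∈ decaying) :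
    entireSum (a + b) = entireSum a + entireSum b := by
  ext w
  refine (hasSum_of_eq ((hasSum_entireSum ha w).add (hasSum_entireSum hb w)) (fun p => ?_)
    rfl).tsum_eq
  simp only [Pi.add_apply]; ring

theorem entireSum_smul {a : ℕ → ℕ → ℂ} (ha : a ∈ decaying) (c : ℂ) :
    entireSum (c • a) = c • entireSum a := by
  ext w
  refine (hasSum_of_eq ((hasSum_entireSum ha w).mul_left c) (fun p => ?_) rfl).tsum_eq
  simp only [Pi.smul_apply, smul_eq_mul]; ring

theorem continuous_entireSum {a : ℕ → ℕ → ℂ} (ha : a ∈ decaying) : Continuous (entireSum a) := by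
  rw [continuous_iff_continuousAt]
  intro w
  obtain ⟨u, hu, h⟩ := exists_summable_bound ha (‖w‖ + 1)
  have hc : ContinuousOn (entireSum a) (ball 0 (‖w‖ + 1)) := by
    refine continuousOn_tsum (fun p => by fun_prop) hu fun p x hx => ?_
    rw [mem_ball, dist_zero_right] at hx
    exact h x ((norm_fst_le x).trans hx.le) ((norm_snd_le x).trans hx.le) p
  exact hc.continuousAt (isOpen_ball.mem_nhds (by simp))

theorem hasDerivAt_entireSum_fst {a : ℕ → ℕ → ℂ} (ha : a ∈ decaying) (w : ℂ × ℂ) :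
    DifferentiableAt ℂ (fun x => entireSum a (x, w.2)) w.1 ∧
      w.1 * deriv (fun x => entireSum a (x, w.2)) w.1
        = entireSum (fun j k => (j : ℂ) * a j k) w := by
  obtain ⟨u, hu, h⟩ := exists_summable_bound ha (‖w‖ + 1)
  have hle : ∀ (p : ℕ × ℕ), ∀ x ∈ ball (0 : ℂ) (‖w‖ + 1),
      ‖a p.1 p.2 * (x ^ p.1 * w.2 ^ p.2)‖ ≤ u p := fun p x hx => by
    rw [mem_ball, dist_zero_right] at hx
    exact h (x, w.2) hx.le ((norm_snd_le w).trans (by linarith)) p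
  have hw : w.1 ∈ ball (0 : ℂ) (‖w‖ + 1) := by
    rw [mem_ball, dist_zero_right]
    linarith [norm_fst_le w]
  refine ⟨(Complex.differentiableOn_tsum_of_summable_norm hu (fun p => by fun_prop) isOpen_ball
    hle).differentiableAt (isOpen_ball.mem_nhds hw), ?_⟩
  have hd := Complex.hasSum_deriv_of_summable_norm hu (fun p => by fun_prop) isOpen_ball hle hw
  refine ((hasSum_of_eq (hd.mul_left w.1) (fun p => ?_) rfl).tsum_eq).symm
  rw [deriv_const_mul_field, deriv_mul_const_field]
  rcases p with ⟨_ | j, k⟩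
  · simp
  · rw [deriv_pow_field, Nat.add_sub_cancel, pow_succ]; ring

theorem entireSum_swap (a : ℕ → ℕ → ℂ) (w : ℂ × ℂ) :
    entireSum a w = entireSum (fun j k => a k j) w.swap := by
  rw [entireSum, entireSum, ← (Equiv.prodComm ℕ ℕ).tsum_eq]
  refine tsum_congr fun p => ?_
  simp [mul_comm]

theorem swap_mem_decaying {a : ℕ → ℕ → ℂ} (ha : a ∈ decaying) :
    (fun j k => a k j) ∈ decaying := by
  intro R hR
  obtain ⟨C, hC⟩ := ha R hR
  exact ⟨C, fun j k => by rw [add_comm]; exact hC k j⟩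

theorem hasDerivAt_entireSum_snd {a : ℕ → ℕ → ℂ} (ha : a ∈ decaying) (w : ℂ × ℂ) :
    DifferentiableAt ℂ (fun x => entireSum a (w.1, x)) w.2 ∧
      w.2 * deriv (fun x => entireSum a (w.1, x)) w.2
        = entireSum (fun j k => (k : ℂ) * a j k) w := by
  have h := hasDerivAt_entireSum_fst (swap_mem_decaying ha) w.swap
  have e : (fun x => entireSum a (w.1, x)) = fun x => entireSum (fun j k => a k j) (x, w.1) := by
    ext x; exact entireSum_swap a _
  rw [e, entireSum_swap _ w]
  exact h

theorem differentiable_entireSum {a : ℕ → ℕ → ℂ} (ha : a ∈ decaying) :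
    Differentiable ℂ (entireSum a) := by
  rw [← differentiableOn_univ]
  exact differentiableOn_of_separately isOpen_univ (continuous_entireSum ha).continuousOn
    (fun w _ => (hasDerivAt_entireSum_fst ha w).1) fun w _ => (hasDerivAt_entireSum_snd ha w).1

theorem entireSum_shift {a : ℕ → ℕ → ℂ} (m₁ m₂ : ℕ) (w : ℂ × ℂ) :
    entireSum (shift m₁ m₂ a) w = w.1 ^ m₁ * w.2 ^ m₂ * entireSum a w := by
  have hinj : Function.Injective fun p : ℕ × ℕ => (p.1 + m₁, p.2 + m₂) := by
    rintro ⟨a, b⟩ ⟨c, d⟩ h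
    simpa using h
  rw [entireSum, entireSum, ← tsum_mul_left, ← hinj.tsum_eq]
  · refine tsum_congr fun p => ?_
    simp only [shift, Nat.le_add_left, and_self, if_true, Nat.add_sub_cancel, pow_add]
    ring
  · rintro ⟨j, k⟩ h
    have : m₁ ≤ j ∧ m₂ ≤ k := by
      by_contra hc
      exact h (by simp [shift, hc])
    exact ⟨(j - m₁, k - m₂), by simp [this]⟩

/-! ### Laurent tails -/

/-- The sum `∑ a j k z₁⁻ʲ z₂⁻ᵏ`. -/
noncomputable def tail (a : ℕ → ℕ → ℂ) (z : ℂ × ℂ) : ℂ := entireSum a (z.1⁻¹, z.2⁻¹)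

theorem isOpen_Aset : IsOpen Aset :=
  (isOpen_ne.preimage continuous_fst).inter (isOpen_ne.preimage continuous_snd)

theorem tail_add {a b : ℕ → ℕ → ℂ} (ha : a ∈ decaying) (hb : b ∈ decaying) :
    tail (a + b) = tail a + tail b := by
  ext z; exact congrFun (entireSum_add ha hb) _

theorem tail_smul {a : ℕ → ℕ → ℂ} (ha : a ∈ decaying) (c : ℂ) : tail (c • a) = c • tail a := by
  ext z; exact congrFun (entireSum_smul ha c) _

theorem tail_sub {a b : ℕ → ℕ → ℂ} (ha : a ∈ decaying) (hb : b ∈ decaying) :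
    tail (a - b) = tail a - tail b := by
  rw [sub_eq_add_neg, ← neg_one_smul ℂ b, tail_add ha (decaying.smul_mem _ hb), tail_smul hb,
    neg_one_smul, sub_eq_add_neg]

theorem differentiableOn_tail {a : ℕ → ℕ → ℂ} (ha : a ∈ decaying) :
    DifferentiableOn ℂ (tail a) Aset :=
  (differentiable_entireSum ha).comp_differentiableOn
    ((differentiableOn_fst.inv fun _ hz => hz.1).prodMk
      (differentiableOn_snd.inv fun _ hz => hz.2))

theorem pd1_tail {a : ℕ → ℕ → ℂ} (ha : a ∈ decaying) {z : ℂ × ℂ} (hz : z ∈ Aset) :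
    pd1 (tail a) z = -(z.1⁻¹ * tail (fun j k => (j : ℂ) * a j k) z) := by
  obtain ⟨h1, h2⟩ := hasDerivAt_entireSum_fst ha (z.1⁻¹, z.2⁻¹)
  have h3 := h1.hasDerivAt.comp z.1 (hasDerivAt_inv hz.1)
  have h4 : pd1 (tail a) z = _ := h3.deriv
  rw [h4, tail, ← h2]
  field_simp

theorem pd2_tail {a : ℕ → ℕ → ℂ} (ha : a ∈ decaying) {z : ℂ × ℂ} (hz : z ∈ Aset) :
    pd2 (tail a) z = -(z.2⁻¹ * tail (fun j k => (k : ℂ) * a j k) z) := by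
  obtain ⟨h1, h2⟩ := hasDerivAt_entireSum_snd ha (z.1⁻¹, z.2⁻¹)
  have h3 := h1.hasDerivAt.comp z.2 (hasDerivAt_inv hz.2)
  have h4 : pd2 (tail a) z = _ := h3.deriv
  rw [h4, tail, ← h2]
  field_simp

theorem φ1_tail (m₁ m₂ : ℕ) {a : ℕ → ℕ → ℂ} (ha : a ∈ decaying) {z : ℂ × ℂ} (hz : z ∈ Aset) :
    φ1 m₁ m₂ (tail a) z = -(z.1⁻¹ * tail (D₁ m₁ m₂ a) z) := by
  have hD : D₁ m₁ m₂ a = (fun (j k : ℕ) => (j : ℂ) * a j k) + (m₁ : ℂ) • shift m₁ m₂ a := rfl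
  have h1 := natCast_mul_mem_decaying ha (fun j _ => j) (by intros; omega)
  have h2 := shift_mem_decaying (m₁ := m₁) (m₂ := m₂) ha
  rw [hD, tail_add h1 (decaying.smul_mem _ h2), tail_smul h2, φ1, pd1_tail ha hz]
  simp only [Pi.add_apply, Pi.smul_apply, smul_eq_mul, tail, entireSum_shift]
  rw [zpow_sub_one₀ hz.1, zpow_neg, zpow_neg, zpow_natCast, zpow_natCast, inv_pow, inv_pow]
  ring

theorem φ2_tail (m₁ m₂ : ℕ) {a : ℕ → ℕ → ℂ} (ha : a ∈ decaying) {z : ℂ × ℂ} (hz : z ∈ Aset) :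
    φ2 m₁ m₂ (tail a) z = -(z.2⁻¹ * tail (D₂ m₁ m₂ a) z) := by
  have hD : D₂ m₁ m₂ a = (fun (j k : ℕ) => (k : ℂ) * a j k) + (m₂ : ℂ) • shift m₁ m₂ a := rfl
  have h1 := natCast_mul_mem_decaying ha (fun _ k => k) (by intros; omega)
  have h2 := shift_mem_decaying (m₁ := m₁) (m₂ := m₂) ha
  rw [hD, tail_add h1 (decaying.smul_mem _ h2), tail_smul h2, φ2, pd2_tail ha hz]
  simp only [Pi.add_apply, Pi.smul_apply, smul_eq_mul, tail, entireSum_shift]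
  rw [zpow_sub_one₀ hz.2, zpow_neg, zpow_neg, zpow_natCast, zpow_natCast, inv_pow, inv_pow]
  ring

/-! ### Laurent decomposition at the crossing point -/

/-- The Laurent coefficient of `z₂^{-k-1}` of `f`, as a function of `z₁`. -/
noncomputable def laurentFun (f : ℂ × ℂ → ℂ) (ε : ℝ) (k : ℕ) (w : ℂ) : ℂ :=
  (2 * Real.pi * Complex.I : ℂ)⁻¹ * ∮ ζ in C(0, ε), ζ ^ k * f (w, ζ)

/-- The Laurent coefficient of `z₁^{-j-1} z₂^{-k-1}` of `f`. -/
noncomputable def laurentCoeff (f : ℂ × ℂ → ℂ) (ε : ℝ) (j k : ℕ) : ℂ :=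
  (2 * Real.pi * Complex.I : ℂ)⁻¹ * ∮ ζ in C(0, ε), ζ ^ j * laurentFun f ε k ζ

/-- The part of `f` that extends across `z₂ = 0`. -/
noncomputable def regularPart (f : ℂ × ℂ → ℂ) (ρ : ℝ) (z : ℂ × ℂ) : ℂ :=
  (2 * Real.pi * Complex.I : ℂ)⁻¹ * ∮ ζ in C(0, ρ), (ζ - z.2)⁻¹ * f (z.1, ζ)

theorem mem_ball_zero_prod {z : ℂ × ℂ} {R : ℝ} : z ∈ ball (0 : ℂ × ℂ) R ↔ ‖z.1‖ < R ∧ ‖z.2‖ < R := by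
  rw [mem_ball, dist_zero_right, Prod.norm_def, max_lt_iff]

theorem isOpen_polydisc (R : ℝ) : IsOpen (ball (0 : ℂ × ℂ) R ∩ Aset) :=
  isOpen_ball.inter isOpen_Aset

section

variable {f : ℂ × ℂ → ℂ} {R : ℝ} (hf : DifferentiableOn ℂ f (ball 0 R ∩ Aset))

include hf

theorem differentiableAt_fst_of_polydisc {w s : ℂ} (hw0 : w ≠ 0) (hw : ‖w‖ < R) (hs0 : s ≠ 0)
    (hs : ‖s‖ < R) : DifferentiableAt ℂ (fun x => f (x, s)) w :=
  differentiableAt_slice_fst (isOpen_polydisc R) hf (z := (w, s))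
    ⟨mem_ball_zero_prod.2 ⟨hw, hs⟩, hw0, hs0⟩

theorem differentiableAt_snd_of_polydisc {w s : ℂ} (hw0 : w ≠ 0) (hw : ‖w‖ < R) (hs0 : s ≠ 0)
    (hs : ‖s‖ < R) : DifferentiableAt ℂ (fun x => f (w, x)) s :=
  differentiableAt_slice_snd (isOpen_polydisc R) hf (z := (w, s))
    ⟨mem_ball_zero_prod.2 ⟨hw, hs⟩, hw0, hs0⟩

theorem differentiableOn_regularPart {ρ : ℝ} (hρ : 0 < ρ) (hρR : ρ < R) :
    DifferentiableOn ℂ (regularPart f ρ) (ball 0 ρ ∩ {z | z.1 ≠ 0}) := by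
  have hU : IsOpen (ball (0 : ℂ × ℂ) ρ ∩ {z | z.1 ≠ 0}) :=
    isOpen_ball.inter (isOpen_ne.preimage continuous_fst)
  have hne : ∀ z ∈ ball (0 : ℂ × ℂ) ρ ∩ {z | z.1 ≠ 0}, ∀ ζ ∈ sphere (0 : ℂ) ρ, ζ - z.2 ≠ 0 := by
    intro z hz ζ hζ h
    rw [mem_sphere, dist_zero_right, sub_eq_zero.1 h] at hζ
    exact (mem_ball_zero_prod.1 hz.1).2.ne hζ
  have hmem : ∀ z ∈ ball (0 : ℂ × ℂ) ρ ∩ {z | z.1 ≠ 0}, ∀ ζ ∈ sphere (0 : ℂ) ρ,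
      (z.1, ζ) ∈ ball (0 : ℂ × ℂ) R ∩ Aset := by
    intro z hz ζ hζ
    refine ⟨mem_ball_zero_prod.2 ⟨(mem_ball_zero_prod.1 hz.1).1.trans hρR, ?_⟩, hz.2,
      ne_of_mem_sphere hζ hρ.ne'⟩
    rw [mem_sphere, dist_zero_right] at hζ
    exact hζ.trans_lt hρR
  refine DifferentiableOn.const_mul (differentiableOn_circleIntegral₂ hU hρ.le ?_ ?_) _
  · refine ContinuousOn.fun_mul (ContinuousOn.inv₀ (by fun_prop) fun p hp => hne _ hp.1 _ hp.2) ?_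
    exact hf.continuousOn.comp (f := fun p : (ℂ × ℂ) × ℂ => (p.1.1, p.2)) (by fun_prop)
      fun p hp => hmem _ hp.1 _ hp.2
  · intro ζ hζ
    refine DifferentiableOn.fun_mul (DifferentiableOn.inv (by fun_prop) fun z hz => hne z hz ζ hζ) ?_
    exact hf.comp (f := fun z : ℂ × ℂ => (z.1, ζ)) (by fun_prop) fun z hz => hmem z hz ζ hζ

theorem differentiableAt_laurentFun {ε : ℝ} (hε : 0 < ε) (hεR : ε < R) (k : ℕ) {w : ℂ}
    (hw0 : w ≠ 0) (hw : ‖w‖ < R) : DifferentiableAt ℂ (laurentFun f ε k) w := by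
  have hU : IsOpen (ball (0 : ℂ) R ∩ {z | z ≠ 0}) := isOpen_ball.inter isOpen_ne
  have hmem : ∀ z ∈ ball (0 : ℂ) R ∩ {z | z ≠ 0}, ∀ ζ ∈ sphere (0 : ℂ) ε,
      (z, ζ) ∈ ball (0 : ℂ × ℂ) R ∩ Aset := by
    intro z hz ζ hζ
    have hz1 := hz.1
    rw [mem_ball, dist_zero_right] at hz1
    refine ⟨mem_ball_zero_prod.2 ⟨hz1, ?_⟩, hz.2, ne_of_mem_sphere hζ hε.ne'⟩
    rw [mem_sphere, dist_zero_right] at hζ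
    exact hζ.trans_lt hεR
  have h : DifferentiableOn ℂ (laurentFun f ε k) (ball (0 : ℂ) R ∩ {z | z ≠ 0}) := by
    refine DifferentiableOn.const_mul (differentiableOn_circleIntegral hU hε.le ?_ ?_) _
    · refine ContinuousOn.fun_mul (by fun_prop) ?_
      exact hf.continuousOn.comp (f := fun p : ℂ × ℂ => (p.1, p.2)) (by fun_prop)
        fun p hp => hmem _ hp.1 _ hp.2
    · intro ζ hζ
      refine DifferentiableOn.const_mul ?_ _
      exact hf.comp (f := fun z : ℂ => (z, ζ)) (by fun_prop) fun z hz => hmem z hz ζ hζ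
  exact h.differentiableAt (hU.mem_nhds ⟨by simpa using hw, hw0⟩)

theorem laurentFun_eq {ε σ : ℝ} (hε : 0 < ε) (hεσ : ε ≤ σ) (hσ : σ < R) (k : ℕ) {w : ℂ}
    (hw0 : w ≠ 0) (hw : ‖w‖ < R) : laurentFun f σ k w = laurentFun f ε k w := by
  rw [laurentFun, laurentFun, circleIntegral_eq_of_punctured hε hεσ hσ fun s hs0 hs => ?_]
  exact DifferentiableAt.fun_mul (by fun_prop) (differentiableAt_snd_of_polydisc hf hw0 hw hs0 hs)

theorem laurentCoeff_eq {ε σ : ℝ} (hε : 0 < ε) (hεσ : ε ≤ σ) (hσ : σ < R) (j k : ℕ) :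
    laurentCoeff f σ j k = laurentCoeff f ε j k := by
  rw [laurentCoeff, laurentCoeff, circleIntegral_eq_of_punctured hε hεσ hσ fun s hs0 hs => ?_]
  · congr 1
    refine circleIntegral.integral_congr hε.le fun ζ hζ => ?_
    have hζ0 : ζ ≠ 0 := ne_of_mem_sphere hζ hε.ne'
    rw [mem_sphere, dist_zero_right] at hζ
    simp only [laurentFun_eq hf hε hεσ hσ k hζ0 (by linarith)]
  · have := differentiableAt_laurentFun hf (hε.trans_le hεσ) hσ k hs0 hs
    fun_prop

theorem exists_laurentFun_bound {ε : ℝ} (hε : 0 < ε) (hεR : ε < R) :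
    ∃ M : ℝ, ∀ k, ∀ w ∈ sphere (0 : ℂ) ε, ‖laurentFun f ε k w‖ ≤ ε * (ε ^ k * M) := by
  have hmem : sphere (0 : ℂ) ε ×ˢ sphere (0 : ℂ) ε ⊆ ball (0 : ℂ × ℂ) R ∩ Aset := by
    rintro ⟨z, ζ⟩ ⟨hz, hζ⟩
    refine ⟨?_, ne_of_mem_sphere hz hε.ne', ne_of_mem_sphere hζ hε.ne'⟩
    rw [mem_sphere, dist_zero_right] at hz hζ
    exact mem_ball_zero_prod.2 ⟨hz.trans_lt hεR, hζ.trans_lt hεR⟩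
  obtain ⟨M, hM⟩ := ((isCompact_sphere (0 : ℂ) ε).prod
    (isCompact_sphere (0 : ℂ) ε)).exists_bound_of_continuousOn (hf.continuousOn.mono hmem)
  refine ⟨M, fun k w hw => ?_⟩
  refine circleIntegral.norm_two_pi_i_inv_smul_integral_le_of_norm_le_const hε.le fun ζ hζ => ?_
  have h := hM (w, ζ) ⟨hw, hζ⟩
  rw [mem_sphere, dist_zero_right] at hζ
  rw [norm_mul, norm_pow, hζ]
  gcongr

theorem laurentCoeff_mem_decaying {σ : ℝ} (hσ : 0 < σ) (hσR : σ < R) :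
    laurentCoeff f σ ∈ decaying := by
  intro r hr
  have hε : 0 < min σ r⁻¹ := lt_min hσ (inv_pos.2 hr)
  obtain ⟨M, hM⟩ := exists_laurentFun_bound hf hε ((min_le_left _ _).trans_lt hσR)
  set ε := min σ r⁻¹ with hεdef
  have hM0 : 0 ≤ M := by
    have h1 := (norm_nonneg _).trans (hM 0 (ε : ℂ) (by simp [abs_of_pos hε]))
    rw [pow_zero, one_mul] at h1
    exact nonneg_of_mul_nonneg_right h1 hε
  refine ⟨ε * (ε * M), fun j k => ?_⟩
  have h1 : ‖laurentCoeff f σ j k‖ ≤ ε * (ε ^ j * (ε * (ε ^ k * M))) := by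
    rw [laurentCoeff_eq hf hε (min_le_left _ _) hσR]
    refine circleIntegral.norm_two_pi_i_inv_smul_integral_le_of_norm_le_const hε.le fun ζ hζ => ?_
    have h := hM k ζ hζ
    rw [mem_sphere, dist_zero_right] at hζ
    rw [norm_mul, norm_pow, hζ]
    gcongr
  have h2 : (ε * r) ^ (j + k) ≤ 1 := by
    refine pow_le_one₀ (by positivity) ?_
    calc ε * r ≤ r⁻¹ * r := by gcongr; exact min_le_right _ _
      _ = 1 := inv_mul_cancel₀ hr.ne'
  calc ‖laurentCoeff f σ j k‖ * r ^ (j + k)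
      ≤ ε * (ε ^ j * (ε * (ε ^ k * M))) * r ^ (j + k) := by gcongr
    _ = ε * (ε * M) * (ε * r) ^ (j + k) := by rw [mul_pow, pow_add, pow_add]; ring
    _ ≤ ε * (ε * M) * 1 := by gcongr
    _ = _ := mul_one _

theorem hasSum_laurentFun {ε ρ : ℝ} {w s : ℂ} (hε : 0 < ε) (hεs : ε < ‖s‖) (hsρ : ‖s‖ < ρ)
    (hρ : ρ < R) (hw0 : w ≠ 0) (hw : ‖w‖ < R) :
    HasSum (fun k => laurentFun f ε k w * s⁻¹ ^ (k + 1)) (f (w, s) - regularPart f ρ (w, s)) :=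
  hasSum_principalPart hε hεs hsρ hρ fun _ hx0 hx =>
    differentiableAt_snd_of_polydisc hf hw0 hw hx0 hx

theorem hasSum_laurentCoeff {ε ρ : ℝ} {s : ℂ} (hε : 0 < ε) (hεs : ε < ‖s‖) (hsρ : ‖s‖ < ρ)
    (hρ : ρ < R) (j : ℕ) :
    HasSum (fun k => laurentCoeff f ε j k * s⁻¹ ^ (k + 1))
      ((2 * Real.pi * Complex.I : ℂ)⁻¹ *
        ∮ ζ in C(0, ε), ζ ^ j * (f (ζ, s) - regularPart f ρ (ζ, s))) := by
  obtain ⟨M, hM⟩ := exists_laurentFun_bound hf hε (by linarith)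
  have hq : ε / ‖s‖ < 1 := (div_lt_one (hε.trans hεs)).2 hεs
  have h1 := hasSum_circleIntegral (ι := ℕ) hε.le
    (F := fun k ζ => s⁻¹ ^ (k + 1) * (ζ ^ j * laurentFun f ε k ζ))
    (G := fun ζ => ζ ^ j * (f (ζ, s) - regularPart f ρ (ζ, s)))
    (u := fun k => (ε / ‖s‖) ^ k * (‖s‖⁻¹ * (ε ^ j * (ε * M))))
    ((summable_geometric_of_lt_one (by positivity) hq).mul_right _)
    (fun k => by
      have : ContinuousOn (laurentFun f ε k) (sphere 0 ε) := fun ζ hζ =>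
        (differentiableAt_laurentFun hf hε (by linarith) k (ne_of_mem_sphere hζ hε.ne') (by
          rw [mem_sphere, dist_zero_right] at hζ; linarith)).continuousAt.continuousWithinAt
      fun_prop)
    (fun k ζ hζ => by
      have h := hM k ζ hζ
      rw [mem_sphere, dist_zero_right] at hζ
      rw [norm_mul, norm_mul, norm_pow, norm_pow, norm_inv, hζ]
      calc ‖s‖⁻¹ ^ (k + 1) * (ε ^ j * ‖laurentFun f ε k ζ‖)
          ≤ ‖s‖⁻¹ ^ (k + 1) * (ε ^ j * (ε * (ε ^ k * M))) := by gcongr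
        _ = (ε / ‖s‖) ^ k * (‖s‖⁻¹ * (ε ^ j * (ε * M))) := by
            rw [div_pow, pow_succ, inv_pow]; ring)
    (fun ζ hζ => by
      have hζ0 := ne_of_mem_sphere hζ hε.ne'
      rw [mem_sphere, dist_zero_right] at hζ
      exact hasSum_of_eq ((hasSum_laurentFun hf hε hεs hsρ hρ hζ0 (by linarith)).mul_left (ζ ^ j))
        (fun k => by ring) rfl)
  refine hasSum_of_eq (h1.mul_left (2 * Real.pi * Complex.I : ℂ)⁻¹) (fun k => ?_) rfl
  rw [circleIntegral.integral_const_mul, laurentCoeff]; ring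

/-- Near the crossing point, a holomorphic function on the complement of the axes is a Laurent
tail up to functions extending across one of the axes. -/
theorem exists_laurent_decomposition (hR : 0 < R) :
    ∃ a ∈ decaying, ∃ f₁ f₂ : ℂ × ℂ → ℂ, ∃ σ > 0,
      DifferentiableOn ℂ f₁ (ball 0 σ ∩ {z | z.1 ≠ 0}) ∧
      DifferentiableOn ℂ f₂ (ball 0 σ ∩ {z | z.2 ≠ 0}) ∧
      ∀ z ∈ ball 0 σ ∩ Aset, f z = f₁ z + f₂ z + tail a z := by
  have hρ : 0 < R / 2 := by positivity
  have hσ : 0 < R / 4 := by positivity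
  set ρ := R / 2 with hρdef
  set σ := R / 4 with hσdef
  have hρR : ρ < R := by linarith
  have hσρ : σ < ρ := by linarith
  have hf₁ := differentiableOn_regularPart hf hρ hρR
  set f₁ := regularPart f ρ with hf₁def
  have hfm : DifferentiableOn ℂ (fun z => f z - f₁ z) (ball 0 ρ ∩ Aset) :=
    (hf.mono (inter_subset_inter_left _ (ball_subset_ball hρR.le))).fun_sub
      (hf₁.mono (inter_subset_inter_right _ fun z hz => hz.1))
  have hs : Differentiable ℂ (Prod.swap : ℂ × ℂ → ℂ × ℂ) :=
    differentiable_snd.prodMk differentiable_fst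
  have hfs : DifferentiableOn ℂ (fun z : ℂ × ℂ => f z.swap - f₁ z.swap) (ball 0 ρ ∩ Aset) :=
    hfm.comp (f := Prod.swap) hs.differentiableOn fun z hz =>
      ⟨mem_ball_zero_prod.2 (mem_ball_zero_prod.1 hz.1).symm, hz.2.symm⟩
  have hf₂ := differentiableOn_regularPart hfs hσ hσρ
  set f₂ := regularPart (fun z : ℂ × ℂ => f z.swap - f₁ z.swap) σ with hf₂def
  have hdec := laurentCoeff_mem_decaying hf hσ (by linarith)
  refine ⟨shift 1 1 (laurentCoeff f σ), shift_mem_decaying hdec, f₁, f₂ ∘ Prod.swap, σ, hσ,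
    hf₁.mono (inter_subset_inter_left _ (ball_subset_ball hσρ.le)),
    hf₂.comp (f := Prod.swap) hs.differentiableOn fun z hz =>
      ⟨mem_ball_zero_prod.2 (mem_ball_zero_prod.1 hz.1).symm, hz.2⟩, ?_⟩
  rintro ⟨z, s⟩ ⟨hz, hz0, hs0⟩
  rw [mem_ball_zero_prod] at hz
  obtain ⟨hz1, hz2⟩ := hz
  dsimp only at hz1 hz2 hz0 hs0
  obtain ⟨ε, hε, hεlt⟩ := exists_between
    (lt_min (norm_pos_iff.2 hz0) (norm_pos_iff.2 hs0))
  obtain ⟨hεz, hεs⟩ := lt_min_iff.1 hεlt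
  have h1 := hasSum_laurentCoeff hf (ρ := ρ) hε hεs (by linarith) hρR
  have h2 := hasSum_principalPart (g := fun w => f (w, s) - f₁ (w, s)) hε hεz hz1 hσρ
    fun w hw0 hw => differentiableAt_fst_of_polydisc hfm hw0 hw hs0 (by linarith)
  have h3 := hasSum_entireSum hdec (z⁻¹, s⁻¹)
  have h4 := (h3.prod_fiberwise (g := fun j => z⁻¹ ^ j * (s * _)) fun j =>
    hasSum_of_eq (((h1 j).mul_left s).mul_left (z⁻¹ ^ j)) (fun k => by
      rw [laurentCoeff_eq hf hε (by linarith) (by linarith : σ < R)]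
      dsimp only
      rw [pow_succ s⁻¹ k]
      field_simp) rfl).mul_left (z⁻¹ * s⁻¹)
  have h5 := (hasSum_of_eq h4 (fun j => by rw [pow_succ]; field_simp; rfl) rfl).unique h2
  have h6 : tail (shift 1 1 (laurentCoeff f σ)) (z, s)
      = z⁻¹ * s⁻¹ * entireSum (laurentCoeff f σ) (z⁻¹, s⁻¹) := by
    rw [tail, entireSum_shift, pow_one, pow_one]
  have h7 : (f₂ ∘ Prod.swap) (z, s) = (2 * Real.pi * Complex.I : ℂ)⁻¹ *
      ∮ ζ in C(0, σ), (ζ - z)⁻¹ * (f (ζ, s) - f₁ (ζ, s)) := rfl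
  rw [h6, h5, h7]
  ring

end

section

/-! ### Germs along the complement of the axes -/

theorem exists_ball_subset {V : Set (ℂ × ℂ)} (hV : IsOpen V) (h0 : ((0 : ℂ), (0 : ℂ)) ∈ V) :
    ∃ R > 0, ball (0 : ℂ × ℂ) R ⊆ V :=
  Metric.isOpen_iff.1 hV _ h0

theorem mem_Esp_iff {f : ℂ × ℂ → ℂ} :
    f ∈ Esp ↔ ∃ R > 0, DifferentiableOn ℂ f (ball 0 R ∩ Aset) := by
  constructor
  · rintro ⟨V, hV, h0, hf⟩
    obtain ⟨R, hR, hRV⟩ := exists_ball_subset hV h0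
    exact ⟨R, hR, hf.mono (inter_subset_inter_left _ hRV)⟩
  · rintro ⟨R, hR, hf⟩
    exact ⟨ball 0 R, isOpen_ball, mem_ball_self hR, hf⟩

/-- `z₂ ^ N * f` extends holomorphically across `z₂ = 0` on the polydisc of radius `R`. -/
def ExtendsAcross (R : ℝ) (N : ℕ) (f : ℂ × ℂ → ℂ) : Prop :=
  ∃ g : ℂ × ℂ → ℂ, DifferentiableOn ℂ g (ball 0 R ∩ {z | z.1 ≠ 0}) ∧
    ∀ z ∈ ball 0 R ∩ Aset, g z = z.2 ^ N * f z

theorem ExtendsAcross.mono {R R' : ℝ} {N N' : ℕ} {f : ℂ × ℂ → ℂ} (h : ExtendsAcross R N f)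
    (hR : R' ≤ R) (hN : N ≤ N') : ExtendsAcross R' N' f := by
  obtain ⟨g, hg, hgf⟩ := h
  refine ⟨fun z => z.2 ^ (N' - N) * g z, DifferentiableOn.fun_mul (by fun_prop)
    (hg.mono (inter_subset_inter_left _ (ball_subset_ball hR))), fun z hz => ?_⟩
  dsimp only
  rw [hgf z ⟨ball_subset_ball hR hz.1, hz.2⟩, ← mul_assoc, ← pow_add, Nat.sub_add_cancel hN]

theorem mem_L1set_iff {f : ℂ × ℂ → ℂ} : f ∈ L1set ↔ ∃ R > 0, ∃ N, ExtendsAcross R N f := by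
  constructor
  · rintro ⟨V, hV, h0, N, g, hg, hgf⟩
    obtain ⟨R, hR, hRV⟩ := exists_ball_subset hV h0
    exact ⟨R, hR, N, g, hg.mono (inter_subset_inter_left _ hRV), fun z hz =>
      hgf z ⟨hRV hz.1, hz.2⟩⟩
  · rintro ⟨R, hR, N, g, hg, hgf⟩
    exact ⟨ball 0 R, isOpen_ball, mem_ball_self hR, N, g, hg, hgf⟩

theorem swap_mem_ball {z : ℂ × ℂ} {R : ℝ} (hz : z ∈ ball (0 : ℂ × ℂ) R) :
    z.swap ∈ ball (0 : ℂ × ℂ) R :=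
  mem_ball_zero_prod.2 (mem_ball_zero_prod.1 hz).symm

theorem differentiable_swap : Differentiable ℂ (Prod.swap : ℂ × ℂ → ℂ × ℂ) :=
  differentiable_snd.prodMk differentiable_fst

theorem mem_L2set_iff {f : ℂ × ℂ → ℂ} :
    f ∈ L2set ↔ ∃ R > 0, ∃ N, ExtendsAcross R N (f ∘ Prod.swap) := by
  constructor
  · rintro ⟨V, hV, h0, N, g, hg, hgf⟩
    obtain ⟨R, hR, hRV⟩ := exists_ball_subset hV h0
    exact ⟨R, hR, N, g ∘ Prod.swap, hg.comp differentiable_swap.differentiableOn fun z hz =>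
      ⟨hRV (swap_mem_ball hz.1), hz.2⟩, fun z hz => hgf _ ⟨hRV (swap_mem_ball hz.1), hz.2.symm⟩⟩
  · rintro ⟨R, hR, N, g, hg, hgf⟩
    exact ⟨ball 0 R, isOpen_ball, mem_ball_self hR, N, g ∘ Prod.swap,
      hg.comp differentiable_swap.differentiableOn fun z hz => ⟨swap_mem_ball hz.1, hz.2⟩,
      fun z hz => hgf _ ⟨swap_mem_ball hz.1, hz.2.symm⟩⟩

theorem comp_swap_mem_L1set {f : ℂ × ℂ → ℂ} : f ∘ Prod.swap ∈ L1set ↔ f ∈ L2set := by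
  rw [mem_L1set_iff, mem_L2set_iff]

theorem comp_swap_mem_Esp {f : ℂ × ℂ → ℂ} (hf : f ∈ Esp) : f ∘ Prod.swap ∈ Esp := by
  obtain ⟨R, hR, hf⟩ := mem_Esp_iff.1 hf
  exact mem_Esp_iff.2 ⟨R, hR, hf.comp differentiable_swap.differentiableOn fun z hz =>
    ⟨swap_mem_ball hz.1, hz.2.symm⟩⟩

/-- Representatives of germs along the complement of the axes, as a submodule. -/
def espSubmodule : Submodule ℂ (ℂ × ℂ → ℂ) where
  carrier := Esp
  zero_mem' := mem_Esp_iff.2 ⟨1, one_pos, differentiableOn_const 0⟩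
  add_mem' := by
    intro f g hf hg
    obtain ⟨R, hR, hf⟩ := mem_Esp_iff.1 hf
    obtain ⟨S, hS, hg⟩ := mem_Esp_iff.1 hg
    exact mem_Esp_iff.2 ⟨min R S, lt_min hR hS,
      (hf.mono (inter_subset_inter_left _ (ball_subset_ball (min_le_left _ _)))).add
        (hg.mono (inter_subset_inter_left _ (ball_subset_ball (min_le_right _ _))))⟩
  smul_mem' := by
    intro c f hf
    obtain ⟨R, hR, hf⟩ := mem_Esp_iff.1 hf
    exact mem_Esp_iff.2 ⟨R, hR, hf.const_smul c⟩

/-- Representatives of germs meromorphic along `z₂ = 0`, as a submodule. -/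
def l₁Submodule : Submodule ℂ (ℂ × ℂ → ℂ) where
  carrier := L1set
  zero_mem' := mem_L1set_iff.2 ⟨1, one_pos, 0, 0, differentiableOn_const 0, fun z _ => by simp⟩
  add_mem' := by
    intro f g hf hg
    obtain ⟨R, hR, N, hf⟩ := mem_L1set_iff.1 hf
    obtain ⟨S, hS, M, hg⟩ := mem_L1set_iff.1 hg
    obtain ⟨f', hf', hff'⟩ := hf.mono (min_le_left R S) (le_max_left N M)
    obtain ⟨g', hg', hgg'⟩ := hg.mono (min_le_right R S) (le_max_right N M)
    refine mem_L1set_iff.2 ⟨_, lt_min hR hS, max N M, f' + g', hf'.add hg', fun z hz => ?_⟩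
    rw [Pi.add_apply, hff' z hz, hgg' z hz, Pi.add_apply, mul_add]
  smul_mem' := by
    intro c f hf
    obtain ⟨R, hR, N, g, hg, hgf⟩ := mem_L1set_iff.1 hf
    refine mem_L1set_iff.2 ⟨R, hR, N, c • g, hg.const_smul c, fun z hz => ?_⟩
    rw [Pi.smul_apply, hgf z hz, Pi.smul_apply, mul_smul_comm]

/-- Representatives of germs meromorphic along `z₁ = 0`, as a submodule. -/
def l₂Submodule : Submodule ℂ (ℂ × ℂ → ℂ) :=
  l₁Submodule.comap (LinearMap.funLeft ℂ ℂ Prod.swap)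

theorem mem_l₂Submodule {f : ℂ × ℂ → ℂ} : f ∈ l₂Submodule ↔ f ∈ L2set := comp_swap_mem_L1set

/-- Representatives of sums of germs that are meromorphic along one of the axes, as a
submodule. -/
def lSubmodule : Submodule ℂ (ℂ × ℂ → ℂ) := l₁Submodule ⊔ l₂Submodule

theorem mem_lSubmodule {f : ℂ × ℂ → ℂ} : f ∈ lSubmodule ↔ f ∈ L12set := by
  rw [lSubmodule, Submodule.mem_sup]
  constructor
  · rintro ⟨g, hg, h, hh, rfl⟩
    exact ⟨g, h, hg, mem_l₂Submodule.1 hh, rfl⟩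
  · rintro ⟨g, h, hg, hh, rfl⟩
    exact ⟨g, hg, h, mem_l₂Submodule.2 hh, rfl⟩

theorem comp_swap_mem_lSubmodule {f : ℂ × ℂ → ℂ} (hf : f ∈ lSubmodule) :
    f ∘ Prod.swap ∈ lSubmodule := by
  obtain ⟨g, hg, h, hh, rfl⟩ := Submodule.mem_sup.1 hf
  refine Submodule.mem_sup.2 ⟨h ∘ Prod.swap, hh, g ∘ Prod.swap, ?_, ?_⟩
  · exact mem_l₂Submodule.2 (comp_swap_mem_L1set.1 hg)
  · exact add_comm _ _

theorem mem_nhdsWithin_Aset {s : Set (ℂ × ℂ)} :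
    s ∈ 𝓝[Aset] (0 : ℂ × ℂ) ↔ ∃ R > 0, ball 0 R ∩ Aset ⊆ s := mem_nhdsWithin_iff

theorem mem_l₁Submodule_congr {f g : ℂ × ℂ → ℂ} (hf : f ∈ l₁Submodule)
    (h : f =ᶠ[𝓝[Aset] 0] g) : g ∈ l₁Submodule := by
  obtain ⟨R, hR, N, hf⟩ := mem_L1set_iff.1 hf
  obtain ⟨S, hS, hS'⟩ := mem_nhdsWithin_Aset.1 h
  obtain ⟨f', hf', hff'⟩ := hf.mono (min_le_left R S) le_rfl
  refine mem_L1set_iff.2 ⟨_, lt_min hR hS, N, f', hf', fun z hz => ?_⟩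
  rw [hff' z hz, hS' ⟨ball_subset_ball (min_le_right R S) hz.1, hz.2⟩]

theorem mem_lSubmodule_of_eventuallyEq_zero {f : ℂ × ℂ → ℂ} (h : f =ᶠ[𝓝[Aset] 0] 0) :
    f ∈ lSubmodule :=
  (le_sup_left : l₁Submodule ≤ lSubmodule) (mem_l₁Submodule_congr l₁Submodule.zero_mem h.symm)

theorem smodEq_of_eventuallyEq {f g : ℂ × ℂ → ℂ} (h : f =ᶠ[𝓝[Aset] 0] g) :
    f ≡ g [SMOD lSubmodule] :=
  SModEq.sub_mem.2 (mem_lSubmodule_of_eventuallyEq_zero (by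
    filter_upwards [h] with z hz
    simp [hz]))

theorem mem_espSubmodule_of_l₁ {f : ℂ × ℂ → ℂ} (hf : f ∈ l₁Submodule) : f ∈ espSubmodule := by
  obtain ⟨R, hR, N, g, hg, hgf⟩ := mem_L1set_iff.1 hf
  refine mem_Esp_iff.2 ⟨R, hR, ?_⟩
  have h : DifferentiableOn ℂ (fun z : ℂ × ℂ => (z.2 ^ N)⁻¹ * g z) (ball 0 R ∩ Aset) :=
    DifferentiableOn.fun_mul (DifferentiableOn.inv (by fun_prop) fun z hz => pow_ne_zero N hz.2.2)
      (hg.mono (inter_subset_inter_right _ fun z hz => hz.1))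
  refine h.congr fun z hz => ?_
  rw [hgf z hz, inv_mul_cancel_left₀ (pow_ne_zero N hz.2.2)]

theorem lSubmodule_le : lSubmodule ≤ espSubmodule :=
  sup_le (fun _ => mem_espSubmodule_of_l₁) fun _ hf =>
    comp_swap_mem_Esp (mem_espSubmodule_of_l₁ hf)

/-! ### Stability under the operators -/

/-- Multiplication by the Laurent monomial `z₁ ^ p * z₂ ^ q`. -/
noncomputable def monomialMul (p q : ℤ) : (ℂ × ℂ → ℂ) →ₗ[ℂ] (ℂ × ℂ → ℂ) :=
  LinearMap.mulLeft ℂ fun z => z.1 ^ p * z.2 ^ q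

theorem monomialMul_apply (p q : ℤ) (f : ℂ × ℂ → ℂ) (z : ℂ × ℂ) :
    monomialMul p q f z = z.1 ^ p * z.2 ^ q * f z := rfl

theorem monomialMul_monomialMul (p q p' q' : ℤ) (f : ℂ × ℂ → ℂ) :
    monomialMul p q (monomialMul p' q' f) =ᶠ[𝓝[Aset] 0] monomialMul (p + p') (q + q') f := by
  filter_upwards [self_mem_nhdsWithin] with z hz
  simp only [monomialMul_apply, zpow_add₀ hz.1, zpow_add₀ hz.2]
  ring

theorem monomialMul_comp_swap (p q : ℤ) (f : ℂ × ℂ → ℂ) :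
    monomialMul p q f ∘ Prod.swap = monomialMul q p (f ∘ Prod.swap) := by
  ext z
  simp only [monomialMul_apply, Function.comp_apply, Prod.fst_swap, Prod.snd_swap]
  ring

theorem monomialMul_mem_esp (p q : ℤ) {f : ℂ × ℂ → ℂ} (hf : f ∈ espSubmodule) :
    monomialMul p q f ∈ espSubmodule := by
  obtain ⟨R, hR, hf⟩ := mem_Esp_iff.1 hf
  refine mem_Esp_iff.2 ⟨R, hR, DifferentiableOn.mul (DifferentiableOn.fun_mul ?_ ?_) hf⟩
  · exact DifferentiableOn.zpow (by fun_prop) (.inl fun z hz => hz.2.1)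
  · exact DifferentiableOn.zpow (by fun_prop) (.inl fun z hz => hz.2.2)

theorem monomialMul_mem_l₁ (p q : ℤ) {f : ℂ × ℂ → ℂ} (hf : f ∈ l₁Submodule) :
    monomialMul p q f ∈ l₁Submodule := by
  obtain ⟨R, hR, N, g, hg, hgf⟩ := mem_L1set_iff.1 hf
  refine mem_L1set_iff.2 ⟨R, hR, N + q.natAbs,
    fun z => z.1 ^ p * z.2 ^ (q + q.natAbs).toNat * g z, ?_, fun z hz => ?_⟩
  · refine DifferentiableOn.fun_mul (DifferentiableOn.fun_mul ?_ (by fun_prop)) hg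
    exact DifferentiableOn.zpow (by fun_prop) (.inl fun z hz => hz.2)
  · have h : z.2 ^ (q + q.natAbs).toNat = z.2 ^ q * z.2 ^ q.natAbs := by
      rw [← zpow_natCast, ← zpow_natCast, ← zpow_add₀ hz.2.2, Int.toNat_of_nonneg (by omega)]
    dsimp only
    rw [hgf z hz, h, pow_add, monomialMul_apply]
    ring

theorem monomialMul_mem_l (p q : ℤ) {f : ℂ × ℂ → ℂ} (hf : f ∈ lSubmodule) :
    monomialMul p q f ∈ lSubmodule := by
  obtain ⟨g, hg, h, hh, rfl⟩ := Submodule.mem_sup.1 hf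
  rw [map_add]
  refine Submodule.add_mem_sup (monomialMul_mem_l₁ p q hg) ?_
  change monomialMul p q h ∘ Prod.swap ∈ l₁Submodule
  rw [monomialMul_comp_swap]
  exact monomialMul_mem_l₁ q p hh

theorem pd1_mem_esp {f : ℂ × ℂ → ℂ} (hf : f ∈ espSubmodule) : pd1 f ∈ espSubmodule := by
  obtain ⟨R, hR, hf⟩ := mem_Esp_iff.1 hf
  exact mem_Esp_iff.2 ⟨R, hR, differentiableOn_pd1 (isOpen_polydisc R) hf⟩

theorem isOpen_ball_inter_fst_ne (R : ℝ) : IsOpen (ball (0 : ℂ × ℂ) R ∩ {z | z.1 ≠ 0}) :=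
  isOpen_ball.inter (isOpen_ne.preimage continuous_fst)

theorem eventuallyEq_of_eqOn {U : Set (ℂ × ℂ)} (hU : IsOpen U) {f g : ℂ × ℂ → ℂ} (h : EqOn f g U)
    {z : ℂ × ℂ} (hz : z ∈ U) : f =ᶠ[𝓝 z] g :=
  h.eventuallyEq_of_mem (hU.mem_nhds hz)

theorem pd1_congr {f g : ℂ × ℂ → ℂ} {z : ℂ × ℂ} (h : f =ᶠ[𝓝 z] g) : pd1 f z = pd1 g z :=
  Filter.EventuallyEq.deriv_eq
    ((by fun_prop : ContinuousAt (fun w : ℂ => (w, z.2)) z.1).eventually h)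

theorem pd2_congr {f g : ℂ × ℂ → ℂ} {z : ℂ × ℂ} (h : f =ᶠ[𝓝 z] g) : pd2 f z = pd2 g z :=
  Filter.EventuallyEq.deriv_eq
    ((by fun_prop : ContinuousAt (fun w : ℂ => (z.1, w)) z.2).eventually h)

theorem pd1_mem_l₁ {f : ℂ × ℂ → ℂ} (hf : f ∈ l₁Submodule) : pd1 f ∈ l₁Submodule := by
  obtain ⟨R, hR, N, g, hg, hgf⟩ := mem_L1set_iff.1 hf
  refine mem_L1set_iff.2 ⟨R, hR, N, pd1 g, differentiableOn_pd1 (isOpen_ball_inter_fst_ne R) hg,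
    fun z hz => ?_⟩
  rw [pd1_congr (eventuallyEq_of_eqOn (isOpen_polydisc R) hgf hz)]
  exact deriv_const_mul_field (z.2 ^ N)

theorem pd2_mem_l₁ {f : ℂ × ℂ → ℂ} (hf : f ∈ l₁Submodule) : pd2 f ∈ l₁Submodule := by
  obtain ⟨S, hS, hfS⟩ := mem_Esp_iff.1 (mem_espSubmodule_of_l₁ hf)
  obtain ⟨R, hR, N, hf⟩ := mem_L1set_iff.1 hf
  obtain ⟨g, hg, hgf⟩ := hf.mono (min_le_left R S) le_rfl
  refine mem_L1set_iff.2 ⟨_, lt_min hR hS, N + 1, fun z => z.2 * pd2 g z - N * g z,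
    ((by fun_prop : DifferentiableOn ℂ (fun z : ℂ × ℂ => z.2) _).fun_mul
      (differentiableOn_pd2 (isOpen_ball_inter_fst_ne _) hg)).fun_sub (hg.const_mul _),
    fun z hz => ?_⟩
  have h1 : DifferentiableAt ℂ (fun w => f (z.1, w)) z.2 :=
    differentiableAt_slice_snd (isOpen_polydisc S) hfS
      ⟨ball_subset_ball (min_le_right R S) hz.1, hz.2⟩
  have h2 : pd2 g z = N * z.2 ^ (N - 1) * f z + z.2 ^ N * pd2 f z := by
    rw [pd2_congr (eventuallyEq_of_eqOn (isOpen_polydisc _) hgf hz)]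
    exact ((hasDerivAt_pow N z.2).mul h1.hasDerivAt).deriv
  dsimp only
  rw [h2, hgf z hz]
  rcases N with _ | N
  · simp
  · rw [Nat.add_sub_cancel]; push_cast; ring

theorem pd1_add_eventuallyEq {f g : ℂ × ℂ → ℂ} (hf : f ∈ espSubmodule) (hg : g ∈ espSubmodule) :
    pd1 (f + g) =ᶠ[𝓝[Aset] 0] pd1 f + pd1 g := by
  obtain ⟨R, hR, hf⟩ := mem_Esp_iff.1 hf
  obtain ⟨S, hS, hg⟩ := mem_Esp_iff.1 hg
  refine mem_nhdsWithin_Aset.2 ⟨min R S, lt_min hR hS, fun z hz => ?_⟩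
  exact deriv_fun_add
    (differentiableAt_slice_fst (isOpen_polydisc R) hf
      ⟨ball_subset_ball (min_le_left R S) hz.1, hz.2⟩)
    (differentiableAt_slice_fst (isOpen_polydisc S) hg
      ⟨ball_subset_ball (min_le_right R S) hz.1, hz.2⟩)

variable (m₁ m₂ : ℕ)

theorem φ1_eq (u : ℂ × ℂ → ℂ) :
    φ1 m₁ m₂ u = pd1 u - (m₁ : ℂ) • monomialMul (-m₁ - 1) (-m₂) u := by
  ext z
  simp only [φ1, Pi.sub_apply, Pi.smul_apply, monomialMul_apply, smul_eq_mul]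
  ring

theorem φ2_eq_swap (u : ℂ × ℂ → ℂ) :
    φ2 m₁ m₂ u = φ1 m₂ m₁ (u ∘ Prod.swap) ∘ Prod.swap := by
  ext z
  simp only [φ1, φ2, Function.comp_apply, Prod.fst_swap, Prod.snd_swap, Prod.swap_swap,
    pd2_eq_pd1_swap]
  ring

theorem ψop_eq (ω₁ ω₂ : ℂ × ℂ → ℂ) : ψop m₁ m₂ ω₁ ω₂ = φ1 m₁ m₂ ω₂ - φ2 m₁ m₂ ω₁ := by
  ext z
  simp only [φ1, φ2, ψop, Pi.sub_apply]
  ring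

variable {m₁ m₂}

theorem φ1_mem_esp {u : ℂ × ℂ → ℂ} (hu : u ∈ espSubmodule) : φ1 m₁ m₂ u ∈ espSubmodule := by
  rw [φ1_eq]
  exact sub_mem (pd1_mem_esp hu) (Submodule.smul_mem _ _ (monomialMul_mem_esp _ _ hu))

theorem φ2_mem_esp {u : ℂ × ℂ → ℂ} (hu : u ∈ espSubmodule) : φ2 m₁ m₂ u ∈ espSubmodule := by
  rw [φ2_eq_swap]
  exact comp_swap_mem_Esp (φ1_mem_esp (comp_swap_mem_Esp hu))

theorem φ1_add_eventuallyEq {u v : ℂ × ℂ → ℂ} (hu : u ∈ espSubmodule) (hv : v ∈ espSubmodule) :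
    φ1 m₁ m₂ (u + v) =ᶠ[𝓝[Aset] 0] φ1 m₁ m₂ u + φ1 m₁ m₂ v := by
  filter_upwards [pd1_add_eventuallyEq hu hv] with z hz
  simp only [φ1_eq, map_add, Pi.sub_apply, Pi.add_apply, Pi.smul_apply, smul_eq_mul, hz]
  ring

theorem φ1_smul (c : ℂ) (u : ℂ × ℂ → ℂ) : φ1 m₁ m₂ (c • u) = c • φ1 m₁ m₂ u := by
  ext z
  have h : pd1 (c • u) z = c * pd1 u z := deriv_const_mul_field _
  simp only [φ1, h, Pi.smul_apply, smul_eq_mul]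
  ring

theorem φ2_smul (c : ℂ) (u : ℂ × ℂ → ℂ) : φ2 m₁ m₂ (c • u) = c • φ2 m₁ m₂ u := by
  rw [φ2_eq_swap, φ2_eq_swap]
  exact congrArg (· ∘ Prod.swap) (φ1_smul c (u ∘ Prod.swap))

theorem φ1_mem_l₁ {u : ℂ × ℂ → ℂ} (hu : u ∈ l₁Submodule) : φ1 m₁ m₂ u ∈ l₁Submodule := by
  rw [φ1_eq]
  exact sub_mem (pd1_mem_l₁ hu) (Submodule.smul_mem _ _ (monomialMul_mem_l₁ _ _ hu))

theorem φ1_mem_l₂ {u : ℂ × ℂ → ℂ} (hu : u ∈ l₂Submodule) : φ1 m₁ m₂ u ∈ l₂Submodule := by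
  rw [φ1_eq]
  refine sub_mem (pd2_mem_l₁ hu : pd1 u ∈ l₂Submodule) (Submodule.smul_mem _ _ ?_)
  change monomialMul _ _ u ∘ Prod.swap ∈ l₁Submodule
  rw [monomialMul_comp_swap]
  exact monomialMul_mem_l₁ _ _ hu

theorem φ1_mem_l {u : ℂ × ℂ → ℂ} (hu : u ∈ lSubmodule) : φ1 m₁ m₂ u ∈ lSubmodule := by
  obtain ⟨g, hg, h, hh, rfl⟩ := Submodule.mem_sup.1 hu
  have hle : ∀ {v}, v ∈ l₂Submodule → v ∈ espSubmodule := fun hv =>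
    lSubmodule_le (Submodule.mem_sup_right hv)
  have h1 := smodEq_of_eventuallyEq
    (φ1_add_eventuallyEq (m₁ := m₁) (m₂ := m₂) (mem_espSubmodule_of_l₁ hg) (hle hh))
  exact SModEq.zero.1 (h1.trans (SModEq.zero.2 (Submodule.add_mem_sup (φ1_mem_l₁ hg)
    (φ1_mem_l₂ hh))))

theorem φ2_mem_l {u : ℂ × ℂ → ℂ} (hu : u ∈ lSubmodule) : φ2 m₁ m₂ u ∈ lSubmodule := by
  rw [φ2_eq_swap]
  exact comp_swap_mem_lSubmodule (φ1_mem_l (comp_swap_mem_lSubmodule hu))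

theorem φ1_add_smodEq {u v : ℂ × ℂ → ℂ} (hu : u ∈ espSubmodule) (hv : v ∈ espSubmodule) :
    φ1 m₁ m₂ (u + v) ≡ φ1 m₁ m₂ u + φ1 m₁ m₂ v [SMOD lSubmodule] :=
  smodEq_of_eventuallyEq (φ1_add_eventuallyEq hu hv)

theorem φ2_add_smodEq {u v : ℂ × ℂ → ℂ} (hu : u ∈ espSubmodule) (hv : v ∈ espSubmodule) :
    φ2 m₁ m₂ (u + v) ≡ φ2 m₁ m₂ u + φ2 m₁ m₂ v [SMOD lSubmodule] := by
  rw [φ2_eq_swap, φ2_eq_swap, φ2_eq_swap]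
  have h := SModEq.sub_mem.1 (φ1_add_smodEq (m₁ := m₂) (m₂ := m₁) (comp_swap_mem_Esp hu)
    (comp_swap_mem_Esp hv))
  exact SModEq.sub_mem.2 (comp_swap_mem_lSubmodule h)

theorem φ1_smodEq {u v : ℂ × ℂ → ℂ} (hu : u ∈ espSubmodule) (h : u ≡ v [SMOD lSubmodule]) :
    φ1 m₁ m₂ v ≡ φ1 m₁ m₂ u [SMOD lSubmodule] := by
  have hl := SModEq.sub_mem.1 h.symm
  have h1 := φ1_add_smodEq (m₁ := m₁) (m₂ := m₂) hu (lSubmodule_le hl)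
  rw [add_sub_cancel] at h1
  exact h1.trans (SModEq.sub_mem.2 (by rw [add_sub_cancel_left]; exact φ1_mem_l hl))

theorem φ2_smodEq {u v : ℂ × ℂ → ℂ} (hu : u ∈ espSubmodule) (h : u ≡ v [SMOD lSubmodule]) :
    φ2 m₁ m₂ v ≡ φ2 m₁ m₂ u [SMOD lSubmodule] := by
  have hl := SModEq.sub_mem.1 h.symm
  have h1 := φ2_add_smodEq (m₁ := m₁) (m₂ := m₂) hu (lSubmodule_le hl)
  rw [add_sub_cancel] at h1
  exact h1.trans (SModEq.sub_mem.2 (by rw [add_sub_cancel_left]; exact φ2_mem_l hl))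

end

section

/-! ### Laurent tails modulo germs meromorphic along one of the axes -/

theorem tail_mem_esp {a : ℕ → ℕ → ℂ} (ha : a ∈ decaying) : tail a ∈ espSubmodule :=
  mem_Esp_iff.2 ⟨1, one_pos, (differentiableOn_tail ha).mono inter_subset_right⟩

theorem exists_smodEq_tail {f : ℂ × ℂ → ℂ} (hf : f ∈ espSubmodule) :
    ∃ a ∈ decaying, f ≡ tail a [SMOD lSubmodule] := by
  obtain ⟨R, hR, hf⟩ := mem_Esp_iff.1 hf
  obtain ⟨a, ha, f₁, f₂, σ, hσ, h₁, h₂, h⟩ := exists_laurent_decomposition hf hR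
  refine ⟨a, ha, ?_⟩
  have e : f =ᶠ[𝓝[Aset] 0] (f₁ + f₂) + tail a := mem_nhdsWithin_Aset.2 ⟨σ, hσ, h⟩
  refine (smodEq_of_eventuallyEq e).trans (SModEq.sub_mem.2 ?_)
  rw [add_sub_cancel_right]
  refine Submodule.add_mem_sup (mem_L1set_iff.2 ⟨σ, hσ, 0, f₁, h₁, fun z _ => by simp⟩)
    (mem_l₂Submodule.2 ⟨ball 0 σ, isOpen_ball, mem_ball_self hσ, 0, f₂, h₂, fun z _ => by simp⟩)

theorem tail_comp_swap (a : ℕ → ℕ → ℂ) : tail a ∘ Prod.swap = tail fun j k => a k j := by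
  ext z
  exact entireSum_swap a _

theorem tail_mem_l₁_of_column {a : ℕ → ℕ → ℂ} (ha : a ∈ decaying) (K : ℕ)
    (h : ∀ j k, k ≠ K → a j k = 0) : tail a ∈ l₁Submodule := by
  refine mem_L1set_iff.2 ⟨1, one_pos, K, fun z => entireSum a (z.1⁻¹, 1), ?_, fun z hz => ?_⟩
  · refine (differentiable_entireSum ha).comp_differentiableOn
      (DifferentiableOn.prodMk (DifferentiableOn.inv (by fun_prop) fun z hz => hz.2)
        (differentiableOn_const 1))
  · refine ((hasSum_entireSum ha _).unique (hasSum_of_eq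
      ((hasSum_entireSum ha (z.1⁻¹, z.2⁻¹)).mul_left (z.2 ^ K)) (fun p => ?_) rfl))
    by_cases hp : p.2 = K
    · have : z.2 ^ K ≠ 0 := pow_ne_zero K hz.2.2
      simp only [hp, one_pow, inv_pow]
      field_simp
    · simp [h _ _ hp]

theorem tail_mem_l₁ {a : ℕ → ℕ → ℂ} (ha : a ∈ decaying) (N : ℕ)
    (h : ∀ j k, N ≤ k → a j k = 0) : tail a ∈ l₁Submodule := by
  induction N generalizing a with
  | zero => exact tail_mem_l₁_of_column ha 0 fun j k _ => h j k k.zero_le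
  | succ N ih =>
    have hb : (fun j k => if k = N then a j k else 0) ∈ decaying :=
      decaying_of_norm_le ha fun j k => by split_ifs <;> simp
    set b : ℕ → ℕ → ℂ := fun j k => if k = N then a j k else 0 with hbdef
    have e : tail a = tail (a - b) + tail b := by
      rw [← tail_add (decaying.sub_mem ha hb) hb, sub_add_cancel]
    rw [e]
    refine add_mem (ih (decaying.sub_mem ha hb) fun j k hk => ?_)
      (tail_mem_l₁_of_column hb N fun j k hk => if_neg hk)
    rcases hk.eq_or_lt with rfl | hk
    · simp [hbdef]
    · simp [hbdef, hk.ne', h j k hk]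

theorem tail_mem_l_of_cornerZero {a : ℕ → ℕ → ℂ} (ha : a ∈ decaying) (h : a ∈ cornerZero) :
    tail a ∈ lSubmodule := by
  obtain ⟨N, hN⟩ := h
  have hb : (fun j k => if k < N then a j k else 0) ∈ decaying :=
    decaying_of_norm_le ha fun j k => by split_ifs <;> simp
  set b : ℕ → ℕ → ℂ := fun j k => if k < N then a j k else 0 with hbdef
  have e : tail a = tail b + tail (a - b) := by
    rw [← tail_add hb (decaying.sub_mem ha hb), add_sub_cancel]
  rw [e]
  refine Submodule.add_mem_sup (tail_mem_l₁ hb N fun j k hk => if_neg hk.not_gt) ?_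
  change tail (a - b) ∘ Prod.swap ∈ l₁Submodule
  rw [tail_comp_swap]
  refine tail_mem_l₁ (swap_mem_decaying (decaying.sub_mem ha hb)) N fun j k hk => ?_
  rcases lt_or_ge j N with hj | hj
  · simp [hbdef, hj]
  · simp [hbdef, hj.not_gt, hN k j hk hj]

theorem circleIntegral_eq_zero_of_ball {g : ℂ → ℂ} {r R : ℝ} (hr : 0 ≤ r) (hrR : r < R)
    (hg : DifferentiableOn ℂ g (ball 0 R)) : ∮ ζ in C(0, r), g ζ = 0 :=
  Complex.circleIntegral_eq_zero_of_differentiable_on_off_countable hr countable_empty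
    (hg.continuousOn.mono (closedBall_subset_ball hrR)) fun _ hz =>
      hg.differentiableAt (isOpen_ball.mem_nhds (ball_subset_ball hrR.le hz.1))

/-- The coefficients of a Laurent tail as iterated residues. -/
theorem circleIntegral_circleIntegral_tail {a : ℕ → ℕ → ℂ} (ha : a ∈ decaying) {r : ℝ}
    (hr : 0 < r) (J K : ℕ) :
    (∮ w in C(0, r), ∮ ζ in C(0, r), w ^ J * ζ ^ K * tail a (w, ζ))
      = (2 * Real.pi * Complex.I) ^ 2 * a (J + 1) (K + 1) := by
  obtain ⟨u, hu, hua⟩ := exists_summable_bound ha r⁻¹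
  have hF : ∀ (p : ℕ × ℕ) (w ζ : ℂ), w ^ J * ζ ^ K * (a p.1 p.2 * (w⁻¹ ^ p.1 * ζ⁻¹ ^ p.2))
      = a p.1 p.2 * (w ^ J * w⁻¹ ^ p.1) * (ζ ^ K * ζ⁻¹ ^ p.2) := fun p w ζ => by ring
  have hnorm : ∀ (p : ℕ × ℕ), ∀ w ∈ sphere (0 : ℂ) r, ∀ ζ ∈ sphere (0 : ℂ) r,
      ‖w ^ J * ζ ^ K * (a p.1 p.2 * (w⁻¹ ^ p.1 * ζ⁻¹ ^ p.2))‖ ≤ r ^ J * r ^ K * u p := by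
    intro p w hw ζ hζ
    rw [mem_sphere, dist_zero_right] at hw hζ
    rw [norm_mul, norm_mul, norm_pow, norm_pow, hw, hζ]
    have := hua (w⁻¹, ζ⁻¹) (by simp [hw]) (by simp [hζ]) p
    gcongr
  have hinv : ContinuousOn (fun w : ℂ => w⁻¹) (sphere 0 r) :=
    ContinuousOn.inv₀ (by fun_prop) fun w hw => ne_of_mem_sphere hw hr.ne'
  have h1 : ∀ w ∈ sphere (0 : ℂ) r,
      HasSum (fun p : ℕ × ℕ => ∮ ζ in C(0, r),
        w ^ J * ζ ^ K * (a p.1 p.2 * (w⁻¹ ^ p.1 * ζ⁻¹ ^ p.2)))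
        (∮ ζ in C(0, r), w ^ J * ζ ^ K * tail a (w, ζ)) := by
    intro w hw
    refine hasSum_circleIntegral hr.le (hu.mul_left (r ^ J * r ^ K)) (fun p => ?_)
      (fun p ζ hζ => hnorm p w hw ζ hζ) fun ζ hζ =>
        (hasSum_entireSum ha (w⁻¹, ζ⁻¹)).mul_left (w ^ J * ζ ^ K)
    exact ContinuousOn.fun_mul (by fun_prop) (continuousOn_const.mul
      (continuousOn_const.mul (hinv.pow p.2)))
  have h2 := hasSum_circleIntegral hr.le ((hu.mul_left (r ^ J * r ^ K)).mul_left (2 * Real.pi * r))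
    (fun p => by
      simp only [hF, circleIntegral.integral_const_mul]
      exact (continuousOn_const.mul (ContinuousOn.fun_mul (by fun_prop) (hinv.pow p.1))).mul
        continuousOn_const)
    (fun p w hw => circleIntegral.norm_integral_le_of_norm_le_const hr.le (hnorm p w hw)) h1
  have h3 : ∀ p : ℕ × ℕ, (∮ w in C(0, r), ∮ ζ in C(0, r),
      w ^ J * ζ ^ K * (a p.1 p.2 * (w⁻¹ ^ p.1 * ζ⁻¹ ^ p.2)))
      = a p.1 p.2 * (if p.2 = K + 1 then (2 * Real.pi * Complex.I : ℂ) else 0) *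
        (if p.1 = J + 1 then (2 * Real.pi * Complex.I : ℂ) else 0) := by
    intro p
    rw [← circleIntegral_pow_mul_inv_pow hr J, ← circleIntegral.integral_const_mul]
    refine circleIntegral.integral_congr hr.le fun w _ => ?_
    simp only [hF, circleIntegral.integral_const_mul, circleIntegral_pow_mul_inv_pow hr]
    ring
  simp only [h3] at h2
  refine h2.unique (hasSum_of_eq (hasSum_single (J + 1, K + 1) fun p hp => ?_) (fun _ => rfl) ?_)
  · rw [Ne, Prod.ext_iff, not_and_or] at hp
    rcases hp with hp | hp <;> simp [hp]
  · simp only [if_true]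
    ring

theorem mem_cornerZero_of_tail_mem_l {a : ℕ → ℕ → ℂ} (ha : a ∈ decaying)
    (h : tail a ∈ lSubmodule) : a ∈ cornerZero := by
  obtain ⟨l₁, h₁, l₂, h₂, hl⟩ := Submodule.mem_sup.1 h
  obtain ⟨R₁, hR₁, N₁, h₁⟩ := mem_L1set_iff.1 h₁
  obtain ⟨R₂, hR₂, N₂, h₂⟩ := mem_L1set_iff.1 h₂
  obtain ⟨g₁, hg₁, hgl₁⟩ := h₁.mono (min_le_left R₁ R₂) (le_max_left N₁ N₂)
  obtain ⟨g₂, hg₂, hgl₂⟩ := h₂.mono (min_le_right R₁ R₂) (le_max_right N₁ N₂)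
  have hR := lt_min hR₁ hR₂
  set R := min R₁ R₂
  set N := max N₁ N₂
  obtain ⟨r, hr, hrR⟩ := exists_between hR
  refine ⟨N + 1, fun j k hj hk => ?_⟩
  obtain ⟨J, rfl⟩ : ∃ J, j = N + J + 1 := ⟨j - N - 1, by omega⟩
  obtain ⟨K, rfl⟩ : ∃ K, k = N + K + 1 := ⟨k - N - 1, by omega⟩
  have hmem : ∀ {w ζ : ℂ}, w ∈ sphere (0 : ℂ) r → ζ ∈ ball (0 : ℂ) R →
      (w, ζ) ∈ ball (0 : ℂ × ℂ) R ∩ {z | z.1 ≠ 0} := by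
    intro w ζ hw hζ
    refine ⟨mem_ball_zero_prod.2 ⟨?_, by simpa using hζ⟩, ne_of_mem_sphere hw hr.ne'⟩
    rw [mem_sphere, dist_zero_right] at hw
    exact hw.trans_lt hrR
  have hsb : sphere (0 : ℂ) r ⊆ ball 0 R := sphere_subset_closedBall.trans
    (closedBall_subset_ball hrR)
  have hin : ∀ w ∈ sphere (0 : ℂ) r,
      (∮ ζ in C(0, r), w ^ (N + J) * ζ ^ (N + K) * tail a (w, ζ))
        = w ^ J * ∮ ζ in C(0, r), ζ ^ (N + K) * g₂ (ζ, w) := by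
    intro w hw
    have hw0 : w ≠ 0 := ne_of_mem_sphere hw hr.ne'
    have hd : DifferentiableOn ℂ (fun ζ => w ^ (N + J) * (ζ ^ K * g₁ (w, ζ))) (ball 0 R) :=
      DifferentiableOn.const_mul (DifferentiableOn.fun_mul (by fun_prop)
        (hg₁.comp (f := fun ζ : ℂ => (w, ζ)) (by fun_prop) fun ζ hζ => hmem hw hζ)) _
    have hd₂ : ContinuousOn (fun ζ => w ^ J * (ζ ^ (N + K) * g₂ (ζ, w))) (sphere 0 r) :=
      continuousOn_const.mul (ContinuousOn.fun_mul (by fun_prop)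
        (hg₂.continuousOn.comp (f := fun ζ : ℂ => (ζ, w)) (by fun_prop)
          fun ζ hζ => hmem hζ (hsb hw)))
    have e₀ := circleIntegral.integral_add ((hd.continuousOn.mono hsb).circleIntegrable hr.le)
      (hd₂.circleIntegrable hr.le)
    rw [circleIntegral_eq_zero_of_ball hr.le hrR hd, zero_add,
      circleIntegral.integral_const_mul] at e₀
    rw [← e₀]
    refine circleIntegral.integral_congr hr.le fun ζ hζ => ?_
    have hζ0 : ζ ≠ 0 := ne_of_mem_sphere hζ hr.ne'
    have e₁ := hgl₁ (w, ζ) ⟨(hmem hw (hsb hζ)).1, hw0, hζ0⟩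
    have e₂ : g₂ (ζ, w) = w ^ N * l₂ (w, ζ) := hgl₂ (ζ, w) ⟨(hmem hζ (hsb hw)).1, hζ0, hw0⟩
    have e₃ : l₁ (w, ζ) + l₂ (w, ζ) = tail a (w, ζ) := congrFun hl (w, ζ)
    dsimp only at e₁ ⊢
    rw [e₁, e₂, ← e₃]
    ring
  have hz : (∮ w in C(0, r), w ^ J * ∮ ζ in C(0, r), ζ ^ (N + K) * g₂ (ζ, w)) = 0 := by
    refine circleIntegral_eq_zero_of_ball hr.le hrR (DifferentiableOn.fun_mul (by fun_prop)
      (differentiableOn_circleIntegral isOpen_ball hr.le ?_ fun ζ hζ => ?_))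
    · exact ContinuousOn.fun_mul (by fun_prop) (hg₂.continuousOn.comp
        (f := fun p : ℂ × ℂ => (p.2, p.1)) (by fun_prop) fun p hp => hmem hp.2 hp.1)
    · exact DifferentiableOn.const_mul (hg₂.comp (f := fun w : ℂ => (ζ, w)) (by fun_prop)
        fun w hw => hmem hζ hw) _
  have key := circleIntegral_circleIntegral_tail ha hr (N + J) (N + K)
  rw [circleIntegral.integral_congr hr.le hin, hz] at key
  exact (mul_eq_zero.1 key.symm).resolve_left (pow_ne_zero 2 Complex.two_pi_I_ne_zero)

/-- The product of a Laurent monomial and a Laurent tail. -/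
noncomputable def monTail (p q : ℤ) (a : ℕ → ℕ → ℂ) : ℂ × ℂ → ℂ := monomialMul p q (tail a)

theorem monTail_mem_esp (p q : ℤ) {a : ℕ → ℕ → ℂ} (ha : a ∈ decaying) :
    monTail p q a ∈ espSubmodule := monomialMul_mem_esp p q (tail_mem_esp ha)

theorem monTail_add (p q : ℤ) {a b : ℕ → ℕ → ℂ} (ha : a ∈ decaying) (hb : b ∈ decaying) :
    monTail p q (a + b) = monTail p q a + monTail p q b := by
  rw [monTail, tail_add ha hb, map_add]; rfl

theorem monTail_smul (p q : ℤ) {a : ℕ → ℕ → ℂ} (ha : a ∈ decaying) (c : ℂ) :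
    monTail p q (c • a) = c • monTail p q a := by
  rw [monTail, tail_smul ha c, map_smul]; rfl

theorem monTail_sub (p q : ℤ) {a b : ℕ → ℕ → ℂ} (ha : a ∈ decaying) (hb : b ∈ decaying) :
    monTail p q (a - b) = monTail p q a - monTail p q b := by
  rw [monTail, tail_sub ha hb, map_sub]; rfl

theorem monomialMul_smodEq (p q : ℤ) {f g : ℂ × ℂ → ℂ} (h : f ≡ g [SMOD lSubmodule]) :
    monomialMul p q f ≡ monomialMul p q g [SMOD lSubmodule] :=
  SModEq.sub_mem.2 (by rw [← map_sub]; exact monomialMul_mem_l p q (SModEq.sub_mem.1 h))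

theorem monomialMul_neg_monomialMul (p q : ℤ) (f : ℂ × ℂ → ℂ) :
    monomialMul p q (monomialMul (-p) (-q) f) ≡ f [SMOD lSubmodule] := by
  refine smodEq_of_eventuallyEq ((monomialMul_monomialMul p q (-p) (-q) f).trans ?_)
  refine Eventually.of_forall fun z => ?_
  simp [monomialMul_apply]

theorem exists_smodEq_monTail (p q : ℤ) {f : ℂ × ℂ → ℂ} (hf : f ∈ espSubmodule) :
    ∃ a ∈ decaying, f ≡ monTail p q a [SMOD lSubmodule] := by
  obtain ⟨a, ha, h⟩ := exists_smodEq_tail (monomialMul_mem_esp (-p) (-q) hf)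
  exact ⟨a, ha, (monomialMul_neg_monomialMul p q f).symm.trans (monomialMul_smodEq p q h)⟩

theorem monTail_mem_l_iff (p q : ℤ) {a : ℕ → ℕ → ℂ} (ha : a ∈ decaying) :
    monTail p q a ∈ lSubmodule ↔ a ∈ cornerZero := by
  refine ⟨fun h => mem_cornerZero_of_tail_mem_l ha ?_, fun h =>
    monomialMul_mem_l p q (tail_mem_l_of_cornerZero ha h)⟩
  have h1 := monomialMul_neg_monomialMul (-p) (-q) (tail a)
  rw [neg_neg, neg_neg] at h1
  exact SModEq.zero.1 (h1.symm.trans (SModEq.zero.2 (monomialMul_mem_l _ _ h)))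

variable {m₁ m₂ : ℕ}

theorem φ1_monTail (q : ℤ) {a : ℕ → ℕ → ℂ} (ha : a ∈ decaying) :
    φ1 m₁ m₂ (monTail 0 q a) ≡ -monTail (-1) q (D₁ m₁ m₂ a) [SMOD lSubmodule] := by
  refine smodEq_of_eventuallyEq ?_
  filter_upwards [self_mem_nhdsWithin] with z hz
  have h : pd1 (monTail 0 q a) z = z.2 ^ q * pd1 (tail a) z := by
    rw [pd1, pd1, ← deriv_const_mul_field]
    congr 1; ext w
    simp [monTail, monomialMul_apply]
  have h' := φ1_tail m₁ m₂ ha hz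
  have h'' : φ1 m₁ m₂ (monTail 0 q a) z = z.2 ^ q * φ1 m₁ m₂ (tail a) z := by
    simp only [φ1, h]
    simp only [monTail, monomialMul_apply, zpow_zero]
    ring
  rw [h'', h', Pi.neg_apply, monTail, monomialMul_apply, zpow_neg_one]
  ring

theorem φ2_monTail (p : ℤ) {a : ℕ → ℕ → ℂ} (ha : a ∈ decaying) :
    φ2 m₁ m₂ (monTail p 0 a) ≡ -monTail p (-1) (D₂ m₁ m₂ a) [SMOD lSubmodule] := by
  refine smodEq_of_eventuallyEq ?_
  filter_upwards [self_mem_nhdsWithin] with z hz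
  have h : pd2 (monTail p 0 a) z = z.1 ^ p * pd2 (tail a) z := by
    rw [pd2, pd2, ← deriv_const_mul_field]
    congr 1; ext w
    simp [monTail, monomialMul_apply]
  have h' := φ2_tail m₁ m₂ ha hz
  have h'' : φ2 m₁ m₂ (monTail p 0 a) z = z.1 ^ p * φ2 m₁ m₂ (tail a) z := by
    simp only [φ2, h]
    simp only [monTail, monomialMul_apply, zpow_zero]
    ring
  rw [h'', h', Pi.neg_apply, monTail, monomialMul_apply, zpow_neg_one]
  ring

end

/-! ### The de Rham complex in terms of Laurent tails -/

theorem finrank_quotient_eq_of_parametrization {M : Type*} [AddCommGroup M] [Module ℂ M]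
    {K L : Submodule ℂ M} {d : ℕ} (F : (Fin d → ℂ) →ₗ[ℂ] M) (hF : ∀ c, F c ∈ K)
    (hinj : ∀ c, F c ∈ L → c = 0) (hsurj : ∀ u ∈ K, ∃ c, u - F c ∈ L) :
    Module.finrank ℂ (K ⧸ L.comap K.subtype) = d := by
  have hb : Function.Bijective ((L.comap K.subtype).mkQ ∘ₗ F.codRestrict K hF) := by
    constructor
    · rw [← LinearMap.ker_eq_bot, LinearMap.ker_eq_bot']
      intro c hc
      exact hinj c ((Submodule.Quotient.mk_eq_zero (L.comap K.subtype)).1 hc)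
    · intro x
      obtain ⟨⟨u, hu⟩, rfl⟩ := Submodule.Quotient.mk_surjective _ x
      obtain ⟨c, hc⟩ := hsurj u hu
      exact ⟨c, ((Submodule.Quotient.eq (L.comap K.subtype)).2 hc).symm⟩
  rw [← (LinearEquiv.ofBijective _ hb).finrank_eq, Module.finrank_fin_fun]

section

variable {m₁ m₂ : ℕ}

theorem exists_smodEq_neg_monTail (p q : ℤ) {f : ℂ × ℂ → ℂ} (hf : f ∈ espSubmodule) :
    ∃ a ∈ decaying, f ≡ -monTail p q a [SMOD lSubmodule] := by
  obtain ⟨a, ha, h⟩ := exists_smodEq_monTail p q (neg_mem hf)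
  exact ⟨a, ha, by simpa using h.neg⟩

theorem monTail_smodEq_iff (p q : ℤ) {a b : ℕ → ℕ → ℂ} (ha : a ∈ decaying) (hb : b ∈ decaying) :
    monTail p q a ≡ monTail p q b [SMOD lSubmodule] ↔ a - b ∈ cornerZero := by
  rw [SModEq.sub_mem, ← monTail_sub p q ha hb, monTail_mem_l_iff p q (sub_mem ha hb)]

theorem φ1_smodEq_neg_monTail (q : ℤ) {u : ℂ × ℂ → ℂ} {a : ℕ → ℕ → ℂ} (ha : a ∈ decaying)
    (h : u ≡ monTail 0 q a [SMOD lSubmodule]) :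
    φ1 m₁ m₂ u ≡ -monTail (-1) q (D₁ m₁ m₂ a) [SMOD lSubmodule] :=
  (φ1_smodEq (monTail_mem_esp 0 q ha) h.symm).trans (φ1_monTail q ha)

theorem φ2_smodEq_neg_monTail (p : ℤ) {u : ℂ × ℂ → ℂ} {a : ℕ → ℕ → ℂ} (ha : a ∈ decaying)
    (h : u ≡ monTail p 0 a [SMOD lSubmodule]) :
    φ2 m₁ m₂ u ≡ -monTail p (-1) (D₂ m₁ m₂ a) [SMOD lSubmodule] :=
  (φ2_smodEq (monTail_mem_esp p 0 ha) h.symm).trans (φ2_monTail p ha)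

theorem φ1_smodEq_monTail (q : ℤ) {u : ℂ × ℂ → ℂ} {a : ℕ → ℕ → ℂ} (ha : a ∈ decaying)
    (h : u ≡ -monTail 0 q a [SMOD lSubmodule]) :
    φ1 m₁ m₂ u ≡ monTail (-1) q (D₁ m₁ m₂ a) [SMOD lSubmodule] := by
  have h' := (φ1_smodEq_neg_monTail (m₁ := m₁) (m₂ := m₂) q ha (by simpa using h.neg)).neg
  rwa [neg_neg, ← neg_one_smul ℂ u, φ1_smul, neg_one_smul, neg_neg] at h'

theorem φ2_smodEq_monTail (p : ℤ) {u : ℂ × ℂ → ℂ} {a : ℕ → ℕ → ℂ} (ha : a ∈ decaying)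
    (h : u ≡ -monTail p 0 a [SMOD lSubmodule]) :
    φ2 m₁ m₂ u ≡ monTail p (-1) (D₂ m₁ m₂ a) [SMOD lSubmodule] := by
  have h' := (φ2_smodEq_neg_monTail (m₁ := m₁) (m₂ := m₂) p ha (by simpa using h.neg)).neg
  rwa [neg_neg, ← neg_one_smul ℂ u, φ2_smul, neg_one_smul, neg_neg] at h'

theorem ψop_mem_l_iff {ω₁ ω₂ : ℂ × ℂ → ℂ} {a b : ℕ → ℕ → ℂ} (ha : a ∈ decaying)
    (hb : b ∈ decaying) (h₁ : ω₁ ≡ monTail (-1) 0 a [SMOD lSubmodule])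
    (h₂ : ω₂ ≡ monTail 0 (-1) b [SMOD lSubmodule]) :
    ψop m₁ m₂ ω₁ ω₂ ∈ lSubmodule ↔ D₁ m₁ m₂ b - D₂ m₁ m₂ a ∈ cornerZero := by
  rw [← monTail_smodEq_iff (-1) (-1) (D₁_mem_decaying hb) (D₂_mem_decaying ha), ψop_eq,
    ← SModEq.sub_mem]
  have e₁ := φ2_smodEq_neg_monTail (m₁ := m₁) (m₂ := m₂) _ ha h₁
  have e₂ := φ1_smodEq_neg_monTail (m₁ := m₁) (m₂ := m₂) _ hb h₂
  constructor
  · intro h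
    simpa using ((e₂.symm.trans h).trans e₁).neg
  · intro h
    exact (e₂.trans h.neg).trans e₁.symm

theorem ψop_φ_mem_l {u : ℂ × ℂ → ℂ} (hu : u ∈ espSubmodule) :
    ψop m₁ m₂ (φ1 m₁ m₂ u) (φ2 m₁ m₂ u) ∈ lSubmodule := by
  obtain ⟨a, ha, h⟩ := exists_smodEq_neg_monTail 0 0 hu
  rw [ψop_mem_l_iff (D₁_mem_decaying ha) (D₂_mem_decaying ha) (φ1_smodEq_monTail 0 ha h)
    (φ2_smodEq_monTail 0 ha h), D₁_D₂_comm, sub_self]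
  exact zero_mem _

theorem exists_sub_ψop_mem_l (hm₁ : 0 < m₁) {η : ℂ × ℂ → ℂ} (hη : η ∈ espSubmodule) :
    ∃ ω ∈ espSubmodule, η - ψop m₁ m₂ 0 ω ∈ lSubmodule := by
  obtain ⟨b, hb, h⟩ := exists_smodEq_monTail (-1) (-1) hη
  obtain ⟨a, ha, hab⟩ := exists_D₁_sub_mem_cornerZero (m₂ := m₂) hm₁ hb
  refine ⟨-monTail 0 (-1) a, neg_mem (monTail_mem_esp 0 (-1) ha), ?_⟩
  have h0 : φ2 m₁ m₂ 0 = 0 := by simpa using φ2_smul (m₁ := m₁) (m₂ := m₂) 0 0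
  rw [ψop_eq, h0, sub_zero, ← SModEq.sub_mem]
  exact (h.trans ((monTail_smodEq_iff _ _ hb (D₁_mem_decaying ha)).2 hab)).trans
    (φ1_smodEq_monTail (-1) ha SModEq.rfl).symm

theorem ψop_smul (c : ℂ) (ω₁ ω₂ : ℂ × ℂ → ℂ) :
    ψop m₁ m₂ (c • ω₁) (c • ω₂) = c • ψop m₁ m₂ ω₁ ω₂ := by
  rw [ψop_eq, ψop_eq, φ1_smul, φ2_smul, smul_sub]

theorem ψop_add_smodEq {ω₁ ω₂ η₁ η₂ : ℂ × ℂ → ℂ} (h₁ : ω₁ ∈ espSubmodule)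
    (h₂ : ω₂ ∈ espSubmodule) (k₁ : η₁ ∈ espSubmodule) (k₂ : η₂ ∈ espSubmodule) :
    ψop m₁ m₂ (ω₁ + η₁) (ω₂ + η₂) ≡ ψop m₁ m₂ ω₁ ω₂ + ψop m₁ m₂ η₁ η₂ [SMOD lSubmodule] := by
  rw [ψop_eq, ψop_eq, ψop_eq, sub_add_sub_comm]
  exact (φ1_add_smodEq h₂ k₂).sub (φ2_add_smodEq h₁ k₁)

theorem ψop_smodEq {ω₁ ω₂ η₁ η₂ : ℂ × ℂ → ℂ} (h₁ : ω₁ ∈ espSubmodule)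
    (h₂ : ω₂ ∈ espSubmodule) (k₁ : ω₁ ≡ η₁ [SMOD lSubmodule]) (k₂ : ω₂ ≡ η₂ [SMOD lSubmodule]) :
    ψop m₁ m₂ η₁ η₂ ≡ ψop m₁ m₂ ω₁ ω₂ [SMOD lSubmodule] := by
  rw [ψop_eq, ψop_eq]
  exact (φ1_smodEq h₂ k₂).sub (φ2_smodEq h₁ k₁)

variable (m₁ m₂)

/-- The preimage in the space of germs of the kernel of the first differential. -/
def kerφ : Submodule ℂ (ℂ × ℂ → ℂ) where
  carrier := {u | u ∈ espSubmodule ∧ φ1 m₁ m₂ u ∈ lSubmodule ∧ φ2 m₁ m₂ u ∈ lSubmodule}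
  add_mem' := fun {_ _} ⟨hu, hu₁, hu₂⟩ ⟨hv, hv₁, hv₂⟩ => ⟨add_mem hu hv,
    SModEq.zero.1 ((φ1_add_smodEq hu hv).trans (SModEq.zero.2 (add_mem hu₁ hv₁))),
    SModEq.zero.1 ((φ2_add_smodEq hu hv).trans (SModEq.zero.2 (add_mem hu₂ hv₂)))⟩
  zero_mem' := ⟨zero_mem _, φ1_mem_l (zero_mem _), φ2_mem_l (zero_mem _)⟩
  smul_mem' := fun c u ⟨hu, hu₁, hu₂⟩ => ⟨Submodule.smul_mem _ c hu,
    by rw [φ1_smul]; exact Submodule.smul_mem _ c hu₁,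
    by rw [φ2_smul]; exact Submodule.smul_mem _ c hu₂⟩

/-- The preimage in the space of pairs of germs of the kernel of the second differential. -/
def kerψ : Submodule ℂ ((ℂ × ℂ → ℂ) × (ℂ × ℂ → ℂ)) where
  carrier := {ω | ω.1 ∈ espSubmodule ∧ ω.2 ∈ espSubmodule ∧ ψop m₁ m₂ ω.1 ω.2 ∈ lSubmodule}
  add_mem' := fun {_ _} ⟨h₁, h₂, h⟩ ⟨k₁, k₂, k⟩ => ⟨add_mem h₁ k₁, add_mem h₂ k₂,
    SModEq.zero.1 ((ψop_add_smodEq h₁ h₂ k₁ k₂).trans (SModEq.zero.2 (add_mem h k)))⟩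
  zero_mem' := ⟨zero_mem _, zero_mem _, by
    rw [ψop_eq]; exact sub_mem (φ1_mem_l (zero_mem _)) (φ2_mem_l (zero_mem _))⟩
  smul_mem' := fun c ω ⟨h₁, h₂, h⟩ => ⟨Submodule.smul_mem _ c h₁, Submodule.smul_mem _ c h₂, by
    rw [Prod.smul_fst, Prod.smul_snd, ψop_smul]; exact Submodule.smul_mem _ c h⟩

/-- The preimage in the space of pairs of germs of the image of the first differential. -/
def imφ : Submodule ℂ ((ℂ × ℂ → ℂ) × (ℂ × ℂ → ℂ)) where
  carrier := {ω | ω.1 ∈ espSubmodule ∧ ω.2 ∈ espSubmodule ∧ ∃ u ∈ espSubmodule,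
    ω.1 - φ1 m₁ m₂ u ∈ lSubmodule ∧ ω.2 - φ2 m₁ m₂ u ∈ lSubmodule}
  add_mem' := fun {_ _} ⟨h₁, h₂, u, hu, hu₁, hu₂⟩ ⟨k₁, k₂, v, hv, hv₁, hv₂⟩ =>
    ⟨add_mem h₁ k₁, add_mem h₂ k₂, u + v, add_mem hu hv,
      SModEq.sub_mem.1 (((SModEq.sub_mem.2 hu₁).add (SModEq.sub_mem.2 hv₁)).trans
        (φ1_add_smodEq hu hv).symm),
      SModEq.sub_mem.1 (((SModEq.sub_mem.2 hu₂).add (SModEq.sub_mem.2 hv₂)).trans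
        (φ2_add_smodEq hu hv).symm)⟩
  zero_mem' := ⟨zero_mem _, zero_mem _, 0, zero_mem _,
    sub_mem (zero_mem _) (φ1_mem_l (zero_mem _)), sub_mem (zero_mem _) (φ2_mem_l (zero_mem _))⟩
  smul_mem' := fun c ω ⟨h₁, h₂, u, hu, hu₁, hu₂⟩ =>
    ⟨Submodule.smul_mem _ c h₁, Submodule.smul_mem _ c h₂, c • u, Submodule.smul_mem _ c hu,
      by rw [φ1_smul, Prod.smul_fst, ← smul_sub]; exact Submodule.smul_mem _ c hu₁,
      by rw [φ2_smul, Prod.smul_snd, ← smul_sub]; exact Submodule.smul_mem _ c hu₂⟩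

theorem lSubmodule_le_kerφ : lSubmodule ≤ kerφ m₁ m₂ :=
  fun _ hu => ⟨lSubmodule_le hu, φ1_mem_l hu, φ2_mem_l hu⟩

theorem imφ_le_kerψ : imφ m₁ m₂ ≤ kerψ m₁ m₂ := fun _ ⟨h₁, h₂, _, hu, hu₁, hu₂⟩ =>
  ⟨h₁, h₂, SModEq.zero.1 ((ψop_smodEq (φ1_mem_esp hu) (φ2_mem_esp hu)
    (SModEq.sub_mem.2 hu₁).symm (SModEq.sub_mem.2 hu₂).symm).trans
      (SModEq.zero.2 (ψop_φ_mem_l hu)))⟩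

end

section

variable {d p q : ℕ} (hd : 0 < d) (hp : 0 < p) (hq : 0 < q) (hpq : p.Coprime q)

/-- The Laurent tails of the sequences `lineSeq`, multiplied by a monomial. -/
noncomputable def lineTail (s t : ℤ) : (Fin d → ℂ) →ₗ[ℂ] (ℂ × ℂ → ℂ) where
  toFun c := monTail s t (lineSeq hd p q c)
  map_add' c c' := by
    rw [lineSeq_add, monTail_add s t (lineSeq_mem_decaying hd hp hq hpq c)
      (lineSeq_mem_decaying hd hp hq hpq c')]
  map_smul' r c := by
    rw [lineSeq_smul, monTail_smul s t (lineSeq_mem_decaying hd hp hq hpq c)]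
    rfl

include hd hp hq hpq

theorem finrank_kerφ : Module.finrank ℂ
    (kerφ (d * p) (d * q) ⧸ lSubmodule.comap (kerφ (d * p) (d * q)).subtype) = d := by
  have hdec := lineSeq_mem_decaying hd hp hq hpq
  refine finrank_quotient_eq_of_parametrization (-lineTail hd hp hq hpq 0 0)
    (fun c => ⟨neg_mem (monTail_mem_esp 0 0 (hdec c)), ?_, ?_⟩) (fun c hc => ?_)
    fun u ⟨hu, hu₁, hu₂⟩ => ?_
  · refine SModEq.zero.1 ((φ1_smodEq_monTail 0 (hdec c) SModEq.rfl).trans (SModEq.zero.2 ?_))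
    exact (monTail_mem_l_iff _ _ (D₁_mem_decaying (hdec c))).2 (D₁_lineSeq_mem hd hp hpq c)
  · refine SModEq.zero.1 ((φ2_smodEq_monTail 0 (hdec c) SModEq.rfl).trans (SModEq.zero.2 ?_))
    exact (monTail_mem_l_iff _ _ (D₂_mem_decaying (hdec c))).2 (D₂_lineSeq_mem hd hp hpq c)
  · exact eq_zero_of_lineSeq_mem hd hp hq
      ((monTail_mem_l_iff 0 0 (hdec c)).1 (neg_mem_iff.1 hc))
  · obtain ⟨a, ha, h⟩ := exists_smodEq_neg_monTail 0 0 hu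
    have e₁ := SModEq.zero.1 ((φ1_smodEq_monTail 0 ha h).symm.trans (SModEq.zero.2 hu₁))
    have e₂ := SModEq.zero.1 ((φ2_smodEq_monTail 0 ha h).symm.trans (SModEq.zero.2 hu₂))
    rw [monTail_mem_l_iff _ _ (D₁_mem_decaying ha)] at e₁
    rw [monTail_mem_l_iff _ _ (D₂_mem_decaying ha)] at e₂
    obtain ⟨c, hc⟩ := exists_sub_lineSeq_mem hd hp hq hpq e₁ e₂
    exact ⟨c, SModEq.sub_mem.1 (h.trans ((monTail_smodEq_iff 0 0 ha (hdec c)).2 hc).neg)⟩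

theorem finrank_kerψ : Module.finrank ℂ (kerψ (d * p) (d * q) ⧸
    (imφ (d * p) (d * q)).comap (kerψ (d * p) (d * q)).subtype) = d := by
  have hdec := lineSeq_mem_decaying hd hp hq hpq
  have h0 : monTail (-1) 0 0 = 0 := by
    simpa using monTail_smul (-1) 0 (zero_mem decaying) 0
  refine finrank_quotient_eq_of_parametrization
    (LinearMap.prod 0 (lineTail hd hp hq hpq 0 (-1)))
    (fun c => ⟨zero_mem _, monTail_mem_esp 0 (-1) (hdec c), ?_⟩)
    (fun c ⟨_, _, u, hu, hu₁, hu₂⟩ => ?_) fun ⟨ω₁, ω₂⟩ ⟨h₁, h₂, h⟩ => ?_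
  · refine (ψop_mem_l_iff (zero_mem decaying) (hdec c) (h0 ▸ SModEq.rfl) SModEq.rfl).2 ?_
    exact sub_mem (D₁_lineSeq_mem hd hp hpq c) (D₂_mem_cornerZero (zero_mem _))
  · obtain ⟨a, ha, h⟩ := exists_smodEq_neg_monTail 0 0 hu
    have e₁ := (SModEq.sub_mem.2 hu₁).trans (φ1_smodEq_monTail 0 ha h)
    have e₂ := (SModEq.sub_mem.2 hu₂).trans (φ2_smodEq_monTail 0 ha h)
    refine eq_zero_of_lineSeq_sub_D₂_mem hd hp hq
      ((monTail_mem_l_iff _ _ (D₁_mem_decaying ha)).1 (SModEq.zero.1 e₁.symm))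
      ((monTail_smodEq_iff 0 (-1) (hdec c) (D₂_mem_decaying ha)).1 e₂)
  · obtain ⟨a, ha, ea⟩ := exists_smodEq_monTail (-1) 0 h₁
    obtain ⟨b, hb, eb⟩ := exists_smodEq_monTail 0 (-1) h₂
    obtain ⟨u, hu, c, k₁, k₂⟩ :=
      exists_cocycle_sub_mem hd hp hq hpq ha hb ((ψop_mem_l_iff ha hb ea eb).1 h)
    refine ⟨c, sub_mem h₁ (zero_mem _), sub_mem h₂ (monTail_mem_esp _ _ (hdec c)),
      -monTail 0 0 u, neg_mem (monTail_mem_esp _ _ hu), SModEq.sub_mem.1 ?_, SModEq.sub_mem.1 ?_⟩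
    · change ω₁ - 0 ≡ _ [SMOD lSubmodule]
      rw [sub_zero]
      exact (ea.trans ((monTail_smodEq_iff _ _ ha (D₁_mem_decaying hu)).2 k₁)).trans
        (φ1_smodEq_monTail 0 hu SModEq.rfl).symm
    · change ω₂ - monTail 0 (-1) (lineSeq hd p q c) ≡ _ [SMOD lSubmodule]
      refine SModEq.trans ?_ (φ2_smodEq_monTail 0 hu SModEq.rfl).symm
      refine (eb.sub SModEq.rfl).trans ?_
      rw [← monTail_sub _ _ hb (hdec c), monTail_smodEq_iff _ _ (sub_mem hb (hdec c))
        (D₂_mem_decaying hu), sub_right_comm]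
      exact k₂

end

end CrossingDeRham

/-- Theorem 4.5 (thm:dRdim) of the paper for the model connection `e^α`,
`α = z₁^{−m₁}z₂^{−m₂}`: the de Rham complex induced by `φ`, `ψ` on
`Q = 𝔈/(𝔏₁+𝔏₂)` has cohomology of dimension `gcd(m₁,m₂)` in degrees `0` and `1`
and vanishes in degree `2`.  All statements about the induced maps are expressed
via representatives of germs. -/
theorem local_deRham_dim_crossing (m₁ m₂ : ℕ) (hm₁ : 0 < m₁) (hm₂ : 0 < m₂) :
    -- (i) φ and ψ preserve 𝔏₁ + 𝔏₂, and ψ̄ ∘ φ̄ = 0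
    (∀ f ∈ L12set, φ1 m₁ m₂ f ∈ L12set ∧ φ2 m₁ m₂ f ∈ L12set) ∧
    (∀ f ∈ L12set, ∀ g ∈ L12set, ψop m₁ m₂ f g ∈ L12set) ∧
    (∀ u ∈ Esp, ψop m₁ m₂ (φ1 m₁ m₂ u) (φ2 m₁ m₂ u) ∈ L12set) ∧
    -- (ii) dim ker φ̄ = gcd(m₁, m₂)
    (∃ K L : Submodule ℂ (ℂ × ℂ → ℂ),
      (∀ u : ℂ × ℂ → ℂ, u ∈ K ↔
        u ∈ Esp ∧ φ1 m₁ m₂ u ∈ L12set ∧ φ2 m₁ m₂ u ∈ L12set) ∧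
      (∀ u : ℂ × ℂ → ℂ, u ∈ L ↔ u ∈ L12set) ∧
      L ≤ K ∧
      Module.finrank ℂ (K ⧸ L.comap K.subtype) = Nat.gcd m₁ m₂) ∧
    -- (iii) dim (ker ψ̄ / im φ̄) = gcd(m₁, m₂)
    (∃ KP IP : Submodule ℂ ((ℂ × ℂ → ℂ) × (ℂ × ℂ → ℂ)),
      (∀ ω : (ℂ × ℂ → ℂ) × (ℂ × ℂ → ℂ), ω ∈ KP ↔
        ω.1 ∈ Esp ∧ ω.2 ∈ Esp ∧ ψop m₁ m₂ ω.1 ω.2 ∈ L12set) ∧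
      (∀ ω : (ℂ × ℂ → ℂ) × (ℂ × ℂ → ℂ), ω ∈ IP ↔
        ω.1 ∈ Esp ∧ ω.2 ∈ Esp ∧ ∃ u ∈ Esp,
          ω.1 - φ1 m₁ m₂ u ∈ L12set ∧ ω.2 - φ2 m₁ m₂ u ∈ L12set) ∧
      IP ≤ KP ∧
      Module.finrank ℂ (KP ⧸ IP.comap KP.subtype) = Nat.gcd m₁ m₂) ∧
    -- (iv) ψ̄ is surjective
    (∀ η ∈ Esp, ∃ ω₁ ∈ Esp, ∃ ω₂ ∈ Esp,
      η - ψop m₁ m₂ ω₁ ω₂ ∈ L12set) := by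
  simp only [← CrossingDeRham.mem_lSubmodule]
  have hd : 0 < m₁.gcd m₂ := Nat.gcd_pos_of_pos_left _ hm₁
  obtain ⟨p, q, hpq, h₁, h₂⟩ := Nat.exists_coprime m₁ m₂
  rw [mul_comm] at h₁ h₂
  have hp : 0 < p := Nat.pos_of_ne_zero fun h => by simp [h] at h₁; omega
  have hq : 0 < q := Nat.pos_of_ne_zero fun h => by simp [h] at h₂; omega
  refine ⟨fun f hf => ⟨CrossingDeRham.φ1_mem_l hf, CrossingDeRham.φ2_mem_l hf⟩,
    fun f hf g hg => ?_, fun u hu => CrossingDeRham.ψop_φ_mem_l hu,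
    ⟨CrossingDeRham.kerφ m₁ m₂, CrossingDeRham.lSubmodule, fun _ => Iff.rfl, fun _ => Iff.rfl,
      CrossingDeRham.lSubmodule_le_kerφ m₁ m₂, ?_⟩,
    ⟨CrossingDeRham.kerψ m₁ m₂, CrossingDeRham.imφ m₁ m₂, fun _ => Iff.rfl, fun _ => Iff.rfl,
      CrossingDeRham.imφ_le_kerψ m₁ m₂, ?_⟩, fun η hη => ?_⟩
  · rw [CrossingDeRham.ψop_eq]
    exact sub_mem (CrossingDeRham.φ1_mem_l hg) (CrossingDeRham.φ2_mem_l hf)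
  · have h := CrossingDeRham.finrank_kerφ hd hp hq hpq
    rwa [← h₁, ← h₂] at h
  · have h := CrossingDeRham.finrank_kerψ hd hp hq hpq
    rwa [← h₁, ← h₂] at h
  · obtain ⟨ω, hω, h⟩ := CrossingDeRham.exists_sub_ψop_mem_l (m₂ := m₂) hm₁ hη
    exact ⟨0, zero_mem CrossingDeRham.espSubmodule, ω, hω, h⟩
end

section
/- Let m₁, m₂ be positive integers, k > 0 a real number, and r₁, r₂ ∈ ℤ. Then there exist a constant C > 0 and an N ∈ ℕ such that for all p₁, p₂ ∈ (0, 1]: the function (x₁, x₂) ↦ exp(−k·x₁^{−m₁}·x₂^{−m₂})·x₁^{−r₁}·x₂^{−r₂} is (Lebesgue-)integrable on (0, p₁] × (0, p₂], and ∫_{(0,p₁]×(0,p₂]} exp(−k·x₁^{−m₁}·x₂^{−m₂})·x₁^{−r₁}·x₂^{−r₂} dx₁ dx₂ ≤ C · p₁^{−N} · p₂^{−N} · exp(−k·p₁^{−m₁}·p₂^{−m₂}). -/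
open MeasureTheory

/-- For `U, t ≥ 1`, the factor `exp (-k U)` can be split off from `exp (-k U t)`, leaving
arbitrary polynomial decay in `t`, uniformly in `U`. -/
lemma exp_neg_mul_mul_le {k U t : ℝ} (hk : 0 < k) (hU : 1 ≤ U) (ht : 1 ≤ t) (n : ℕ) :
    Real.exp (-k * (U * t)) ≤
      n.factorial / k ^ n * Real.exp k * (t ^ n)⁻¹ * Real.exp (-k * U) := by
  have ht0 : 0 < t := by linarith
  have hdecay : Real.exp (-(k * t)) ≤ n.factorial / k ^ n * (t ^ n)⁻¹ := by
    have h := Real.pow_div_factorial_le_exp (k * t) (by positivity) n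
    have h' := inv_anti₀ (by positivity) h
    rw [← Real.exp_neg] at h'
    refine h'.trans (le_of_eq ?_)
    rw [mul_pow]
    field_simp
  calc Real.exp (-k * (U * t))
      ≤ Real.exp (-(k * t) + k + -k * U) := by
        apply Real.exp_le_exp.mpr
        nlinarith [mul_nonneg hk.le (mul_nonneg (sub_nonneg.mpr hU) (sub_nonneg.mpr ht))]
    _ = Real.exp (-(k * t)) * (Real.exp k * Real.exp (-k * U)) := by
        rw [Real.exp_add, Real.exp_add, mul_assoc]
    _ ≤ n.factorial / k ^ n * (t ^ n)⁻¹ * (Real.exp k * Real.exp (-k * U)) := by gcongr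
    _ = _ := by ring

/-- A high enough power of `x ∈ (0, 1]` cancels the pole `x ^ (-r)`. -/
lemma pow_mul_zpow_neg_le_one {x : ℝ} (hx : 0 < x) (hx1 : x ≤ 1) {r : ℤ} {M : ℕ}
    (hr : r ≤ M) : x ^ M * x ^ (-r) ≤ 1 := by
  rw [← zpow_natCast, ← zpow_add₀ hx.ne']
  obtain ⟨j, hj⟩ := Int.eq_ofNat_of_zero_le (show 0 ≤ (M : ℤ) + -r by linarith)
  rw [hj, zpow_natCast]
  exact pow_le_one₀ hx.le hx1

/-- Pointwise version of the estimate: on `(0, p₁] × (0, p₂]` the integrand is bounded by its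
exponential factor at the corner `(p₁, p₂)`, up to moderate growth. -/
lemma exp_neg_mul_zpow_mul_zpow_le {m₁ m₂ : ℕ} (hm₁ : 0 < m₁) (hm₂ : 0 < m₂)
    {k : ℝ} (hk : 0 < k) {r₁ r₂ : ℤ} {n : ℕ} (hr₁ : r₁ ≤ n) (hr₂ : r₂ ≤ n)
    {p₁ p₂ x₁ x₂ : ℝ} (hp₁ : p₁ ≤ 1) (hp₂ : p₂ ≤ 1)
    (hx₁ : x₁ ∈ Set.Ioc 0 p₁) (hx₂ : x₂ ∈ Set.Ioc 0 p₂) :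
    Real.exp (-k * x₁ ^ (-(m₁ : ℤ)) * x₂ ^ (-(m₂ : ℤ))) * x₁ ^ (-r₁) * x₂ ^ (-r₂) ≤
      n.factorial / k ^ n * Real.exp k * p₁ ^ (-(((m₁ + m₂) * n : ℕ) : ℤ)) *
        p₂ ^ (-(((m₁ + m₂) * n : ℕ) : ℤ)) *
          Real.exp (-k * p₁ ^ (-(m₁ : ℤ)) * p₂ ^ (-(m₂ : ℤ))) := by
  obtain ⟨h₁, hxp₁⟩ := hx₁
  obtain ⟨h₂, hxp₂⟩ := hx₂
  have hp₁0 : 0 < p₁ := h₁.trans_le hxp₁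
  have hp₂0 : 0 < p₂ := h₂.trans_le hxp₂
  have hU : 1 ≤ (p₁ ^ m₁)⁻¹ * (p₂ ^ m₂)⁻¹ :=
    one_le_mul_of_one_le_of_one_le
      ((one_le_inv₀ (by positivity)).mpr (pow_le_one₀ hp₁0.le hp₁))
      ((one_le_inv₀ (by positivity)).mpr (pow_le_one₀ hp₂0.le hp₂))
  have ht : 1 ≤ (p₁ / x₁) ^ m₁ * (p₂ / x₂) ^ m₂ :=
    one_le_mul_of_one_le_of_one_le
      (one_le_pow₀ ((one_le_div h₁).mpr hxp₁)) (one_le_pow₀ ((one_le_div h₂).mpr hxp₂))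
  have hexp := exp_neg_mul_mul_le hk hU ht n
  have harg : -k * ((p₁ ^ m₁)⁻¹ * (p₂ ^ m₂)⁻¹ * ((p₁ / x₁) ^ m₁ * (p₂ / x₂) ^ m₂)) =
      -k * (x₁ ^ m₁)⁻¹ * (x₂ ^ m₂)⁻¹ := by
    rw [div_pow, div_pow]
    field_simp
  rw [harg, ← mul_assoc (-k)] at hexp
  have hn₁ : n ≤ m₁ * n := Nat.le_mul_of_pos_left n hm₁
  have hn₂ : n ≤ m₂ * n := Nat.le_mul_of_pos_left n hm₂
  have hpole₁ : x₁ ^ (m₁ * n) * x₁ ^ (-r₁) ≤ 1 :=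
    pow_mul_zpow_neg_le_one h₁ (hxp₁.trans hp₁) (hr₁.trans (by exact_mod_cast hn₁))
  have hpole₂ : x₂ ^ (m₂ * n) * x₂ ^ (-r₂) ≤ 1 :=
    pow_mul_zpow_neg_le_one h₂ (hxp₂.trans hp₂) (hr₂.trans (by exact_mod_cast hn₂))
  have hq₁ : (p₁ ^ (m₁ * n))⁻¹ ≤ (p₁ ^ ((m₁ + m₂) * n))⁻¹ :=
    inv_anti₀ (by positivity) (pow_le_pow_of_le_one hp₁0.le hp₁ (by gcongr; omega))
  have hq₂ : (p₂ ^ (m₂ * n))⁻¹ ≤ (p₂ ^ ((m₁ + m₂) * n))⁻¹ :=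
    inv_anti₀ (by positivity) (pow_le_pow_of_le_one hp₂0.le hp₂ (by gcongr; omega))
  simp only [zpow_neg _ (Nat.cast _), zpow_natCast]
  set E := Real.exp (-k * (p₁ ^ m₁)⁻¹ * (p₂ ^ m₂)⁻¹)
  set D := n.factorial / k ^ n * Real.exp k
  have hD : 0 ≤ D := by positivity
  calc Real.exp (-k * (x₁ ^ m₁)⁻¹ * (x₂ ^ m₂)⁻¹) * x₁ ^ (-r₁) * x₂ ^ (-r₂)
      ≤ D * (((p₁ / x₁) ^ m₁ * (p₂ / x₂) ^ m₂) ^ n)⁻¹ * E * x₁ ^ (-r₁) * x₂ ^ (-r₂) := by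
        gcongr
    _ = D * (p₁ ^ (m₁ * n))⁻¹ * (p₂ ^ (m₂ * n))⁻¹ * E *
          ((x₁ ^ (m₁ * n) * x₁ ^ (-r₁)) * (x₂ ^ (m₂ * n) * x₂ ^ (-r₂))) := by
        rw [mul_pow, div_pow, div_pow, div_pow, div_pow, ← pow_mul, ← pow_mul, ← pow_mul,
          ← pow_mul, mul_inv, inv_div, inv_div]
        ring
    _ ≤ D * (p₁ ^ (m₁ * n))⁻¹ * (p₂ ^ (m₂ * n))⁻¹ * E * 1 := by
        gcongr
        exact mul_le_one₀ hpole₁ (by positivity) hpole₂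
    _ ≤ D * (p₁ ^ ((m₁ + m₂) * n))⁻¹ * (p₂ ^ ((m₁ + m₂) * n))⁻¹ * E := by
        rw [mul_one]
        gcongr

/-- The key analytic estimate in the proof of Theorem 4.10 of the paper: the
integral of the rapidly decaying exponential `exp(−k·x₁^{−m₁}x₂^{−m₂})` against a
meromorphic density `x₁^{−r₁}x₂^{−r₂}` over `(0,p₁] × (0,p₂]` exists and, after
multiplication by `exp(k·p₁^{−m₁}p₂^{−m₂})`, has at worst moderate growth as
`(p₁,p₂) → (0,0)`. -/
theorem rapid_decay_integral_estimate (m₁ m₂ : ℕ) (hm₁ : 0 < m₁) (hm₂ : 0 < m₂)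
    (k : ℝ) (hk : 0 < k) (r₁ r₂ : ℤ) :
    ∃ (C : ℝ) (N : ℕ), 0 < C ∧
      ∀ p₁ p₂ : ℝ, p₁ ∈ Set.Ioc (0 : ℝ) 1 → p₂ ∈ Set.Ioc (0 : ℝ) 1 →
        IntegrableOn
          (fun x : ℝ × ℝ =>
            Real.exp (-k * x.1 ^ (-(m₁ : ℤ)) * x.2 ^ (-(m₂ : ℤ))) *
              x.1 ^ (-r₁) * x.2 ^ (-r₂))
          (Set.Ioc 0 p₁ ×ˢ Set.Ioc 0 p₂) ∧
        (∫ x in Set.Ioc 0 p₁ ×ˢ Set.Ioc 0 p₂,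
            Real.exp (-k * x.1 ^ (-(m₁ : ℤ)) * x.2 ^ (-(m₂ : ℤ))) *
              x.1 ^ (-r₁) * x.2 ^ (-r₂))
          ≤ C * p₁ ^ (-(N : ℤ)) * p₂ ^ (-(N : ℤ)) *
              Real.exp (-k * p₁ ^ (-(m₁ : ℤ)) * p₂ ^ (-(m₂ : ℤ))) := by
  set n := r₁.natAbs + r₂.natAbs with hn
  refine ⟨n.factorial / k ^ n * Real.exp k, (m₁ + m₂) * n, by positivity, ?_⟩
  intro p₁ p₂ hp₁ hp₂
  obtain ⟨hp₁0, hp₁1⟩ := hp₁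
  obtain ⟨hp₂0, hp₂1⟩ := hp₂
  set B := n.factorial / k ^ n * Real.exp k * p₁ ^ (-(((m₁ + m₂) * n : ℕ) : ℤ)) *
    p₂ ^ (-(((m₁ + m₂) * n : ℕ) : ℤ)) *
      Real.exp (-k * p₁ ^ (-(m₁ : ℤ)) * p₂ ^ (-(m₂ : ℤ)))
  have hB0 : 0 ≤ B := by positivity
  have hmeas : MeasurableSet (Set.Ioc 0 p₁ ×ˢ Set.Ioc 0 p₂) :=
    measurableSet_Ioc.prod measurableSet_Ioc
  have hvol : volume (Set.Ioc 0 p₁ ×ˢ Set.Ioc 0 p₂) = ENNReal.ofReal (p₁ * p₂) := by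
    rw [Measure.volume_eq_prod, Measure.prod_prod, Real.volume_Ioc, Real.volume_Ioc,
      sub_zero, sub_zero, ENNReal.ofReal_mul hp₁0.le]
  have hfin : volume (Set.Ioc 0 p₁ ×ˢ Set.Ioc 0 p₂) < ⊤ := hvol ▸ ENNReal.ofReal_lt_top
  have hbound : ∀ x ∈ Set.Ioc 0 p₁ ×ˢ Set.Ioc 0 p₂,
      ‖Real.exp (-k * x.1 ^ (-(m₁ : ℤ)) * x.2 ^ (-(m₂ : ℤ))) *
        x.1 ^ (-r₁) * x.2 ^ (-r₂)‖ ≤ B := by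
    rintro x ⟨hx₁, hx₂⟩
    have h₁ : 0 < x.1 := hx₁.1
    have h₂ : 0 < x.2 := hx₂.1
    rw [Real.norm_of_nonneg (by positivity)]
    exact exp_neg_mul_zpow_mul_zpow_le hm₁ hm₂ hk (by omega) (by omega) hp₁1 hp₂1 hx₁ hx₂
  constructor
  · refine IntegrableOn.of_bound hfin ?_ B ((ae_restrict_iff' hmeas).mpr (.of_forall hbound))
    exact Measurable.aestronglyMeasurable (by fun_prop)
  · refine (Real.le_norm_self _).trans ((norm_setIntegral_le_of_norm_le_const hfin hbound).trans ?_)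
    rw [Measure.real, hvol, ENNReal.toReal_ofReal (by positivity)]
    exact mul_le_of_le_one_right hB0 (mul_le_one₀ hp₁1 hp₂0.le hp₂1)
end
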